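/- arXiv:1404.1016 — 2 statements merged into one kernel-verified Lean document; each statement's English description precedes it below -/
import Mathlib

section
/- Let F be a non-trivial self-similar set in ℝ, i.e. the attractor of an iterated function system of contracting similarities on ℝ that is not a singleton. If the defining IFS satisfies the weak separation property, then the Assouad dimension of F equals its Hausdorff dimension; if the defining IFS does not satisfy the weak separation property, then the Assouad dimension of F equals 1. -/
open Set Metric Filter Function MeasureTheory

/-- The Assouad dimension of a subset of a metric space: the infimum of all `s ≥ 0`
for which there is a constant `K > 0` such that for all `0 < ρ < r ≤ 1`, every ball
of radius `r` centred in the set can be covered by at most `K (r/ρ)^s` open balls of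
radius `ρ`. -/
noncomputable def assouadDim {X : Type*} [MetricSpace X] (A : Set X) : ℝ :=
  sInf {s : ℝ | 0 ≤ s ∧ ∃ K : ℝ, 0 < K ∧ ∀ r ρ : ℝ, 0 < ρ → ρ < r → r ≤ 1 →
    ∀ x ∈ A, ∃ t : Finset X, (A ∩ Metric.ball x r ⊆ ⋃ y ∈ t, Metric.ball y ρ) ∧
      (t.card : ℝ) ≤ K * (r / ρ) ^ s}

/-- The composition `S_{i₁} ∘ ⋯ ∘ S_{i_k}` associated to a finite word. -/
def wordMap {ι X : Type*} (S : ι → X → X) : List ι → X → X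
  | [] => id
  | i :: w => S i ∘ wordMap S w

/-- The weak separation property: the identity is not in the closure (for the topology of
pointwise convergence) of the set of maps `S_α⁻¹ ∘ S_β` for distinct nonempty words
`α ≠ β`, with the identity itself removed. -/
def SatisfiesWSP {ι X : Type*} [Nonempty X] [TopologicalSpace X] (S : ι → X → X) : Prop :=
  id ∉ closure ({g : X → X | ∃ w₁ w₂ : List ι, w₁ ≠ [] ∧ w₂ ≠ [] ∧ w₁ ≠ w₂ ∧
      g = Function.invFun (wordMap S w₁) ∘ wordMap S w₂} \ {id})

lemma similarity_eq_affine {f : ℝ → ℝ} {c : ℝ} (hc : 0 < c)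
    (hf : ∀ x y, dist (f x) (f y) = c * dist x y) :
    ∃ a b : ℝ, |a| = c ∧ ∀ x, f x = a * x + b := by
  have hsq : ∀ x y, (f x - f y) ^ 2 = c ^ 2 * (x - y) ^ 2 := by
    intro x y
    have h := hf x y
    rw [Real.dist_eq, Real.dist_eq] at h
    rw [← sq_abs (f x - f y), h, mul_pow, sq_abs]
  have h10 : |f 1 - f 0| = c := by
    have h := hf 1 0
    rw [Real.dist_eq, Real.dist_eq] at h
    simpa using h
  have hne : f 1 - f 0 ≠ 0 := by
    intro h
    rw [h] at h10
    simp at h10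
    linarith
  refine ⟨f 1 - f 0, f 0, h10, fun x => ?_⟩
  have h1 := hsq x 0
  have h2 := hsq x 1
  have h3 := hsq 1 0
  have h4 : (f 1 - f 0) * (f x - f 0 - (f 1 - f 0) * x) = 0 := by
    linear_combination (1/2 : ℝ) * h1 - (1/2) * h2 + (1/2 - x) * h3
  rcases mul_eq_zero.1 h4 with h | h
  · exact absurd h hne
  · linarith

section IFS

variable {ι : Type} {S : ι → ℝ → ℝ}

lemma wordMap_append (w v : List ι) : wordMap S (w ++ v) = wordMap S w ∘ wordMap S v := by
  induction w with
  | nil => rfl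
  | cons i w ih => simp [wordMap, ih, Function.comp_assoc]

lemma wordMap_mem {F : Set ℝ} (hF : F = ⋃ i, S i '' F) (w : List ι) {x : ℝ} (hx : x ∈ F) :
    wordMap S w x ∈ F := by
  induction w with
  | nil => exact hx
  | cons i w ih =>
    rw [hF]
    exact mem_iUnion.2 ⟨i, _, ih, rfl⟩

lemma wordMap_affine (hS : ∀ i, ∃ a b : ℝ, 0 < |a| ∧ |a| < 1 ∧ ∀ x, S i x = a * x + b)
    (w : List ι) :
    ∃ a b : ℝ, 0 < |a| ∧ |a| ≤ 1 ∧ ∀ x, wordMap S w x = a * x + b := by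
  induction w with
  | nil => exact ⟨1, 0, by simp, by simp, fun x => by simp [wordMap]⟩
  | cons i w ih =>
    obtain ⟨a, b, h0, h1, h⟩ := ih
    obtain ⟨a', b', h0', h1', h'⟩ := hS i
    refine ⟨a' * a, a' * b + b', by rw [abs_mul]; positivity, ?_, fun x => ?_⟩
    · rw [abs_mul]; exact mul_le_one₀ h1'.le h0.le h1
    · simp only [wordMap, Function.comp_apply, h, h']; ring

/-- Every point of the attractor lies in a cylinder of any prescribed approximate size. -/
lemma exists_word_of_size [Finite ι] [Nonempty ι] {c : ι → ℝ}
    (hc : ∀ i, c i ∈ Set.Ioo (0 : ℝ) 1)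
    (hS : ∀ i, ∃ a b : ℝ, |a| = c i ∧ ∀ x, S i x = a * x + b)
    {F : Set ℝ} (hF : F = ⋃ i, S i '' F) :
    ∃ m : ℝ, 0 < m ∧ m < 1 ∧ ∀ p ∈ F, ∀ r : ℝ, 0 < r → r ≤ 1 →
      ∃ w : List ι, w ≠ [] ∧ ∃ q ∈ F, ∃ a b : ℝ, (∀ x, wordMap S w x = a * x + b) ∧
        p = a * q + b ∧ m * r ≤ |a| ∧ |a| < r := by
  obtain ⟨i₀, hi₀⟩ := Finite.exists_min c
  obtain ⟨i₁, hi₁⟩ := Finite.exists_max c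
  refine ⟨c i₀, (hc i₀).1, (hc i₀).2, ?_⟩
  have key : ∀ n : ℕ, ∀ p ∈ F, ∀ r : ℝ, c i₁ ^ n < r → r ≤ 1 →
      ∃ w : List ι, w ≠ [] ∧ ∃ q ∈ F, ∃ a b : ℝ, (∀ x, wordMap S w x = a * x + b) ∧
        p = a * q + b ∧ c i₀ * r ≤ |a| ∧ |a| < r := by
    intro n
    induction n with
    | zero => intro p _ r h1 h2; simp at h1; linarith
    | succ n ih =>
      intro p hp r hr hr1
      have hp' := hp
      rw [hF] at hp'
      obtain ⟨i, q, hq, rfl⟩ := mem_iUnion.1 hp'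
      obtain ⟨a, b, ha, hab⟩ := hS i
      have hci := (hc i).1
      have h0r : 0 < r := lt_trans (pow_pos (hc i₁).1 _) hr
      by_cases hir : c i < r
      · refine ⟨[i], by simp, q, hq, a, b, fun x => by simp [wordMap, hab], hab q, ?_, ha ▸ hir⟩
        rw [ha]
        calc c i₀ * r ≤ c i₀ * 1 := by gcongr; exact (hc i₀).1.le
          _ ≤ c i := by simpa using hi₀ i
      · push Not at hir
        have h1 : c i₁ ^ n < r / c i := by
          rw [lt_div_iff₀ hci]
          calc c i₁ ^ n * c i ≤ c i₁ ^ n * c i₁ := by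
                gcongr
                · exact pow_nonneg (hc i₁).1.le _
                · exact hi₁ i
            _ < r := by rwa [← pow_succ]
        obtain ⟨w, hw, q', hq', a', b', hw', hq'', h2, h3⟩ :=
          ih q hq (r / c i) h1 ((div_le_one hci).2 hir)
        refine ⟨i :: w, by simp, q', hq', a * a', a * b' + b, fun x => ?_, ?_, ?_, ?_⟩
        · simp only [wordMap, Function.comp_apply, hw', hab]; ring
        · rw [hab, hq'']; ring
        · rw [abs_mul, ha]
          calc c i₀ * r = c i * (c i₀ * (r / c i)) := by field_simp
            _ ≤ _ := by gcongr
        · rw [abs_mul, ha]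
          calc c i * |a'| < c i * (r / c i) := by gcongr
            _ = r := by field_simp
  intro p hp r hr hr1
  obtain ⟨n, hn⟩ := exists_pow_lt_of_lt_one hr (hc i₁).2
  exact key n p hp r hn hr1

lemma invFun_comp_affine {f g : ℝ → ℝ} {a b a' b' : ℝ} (ha : a ≠ 0)
    (hf : ∀ x, f x = a * x + b) (hg : ∀ x, g x = a' * x + b') (x : ℝ) :
    (Function.invFun f ∘ g) x = a' / a * x + (b' - b) / a := by
  have hinj : Function.Injective f := by
    intro x y h
    rw [hf, hf] at h
    exact mul_left_cancel₀ ha (add_right_cancel h)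
  have : g x = f (a' / a * x + (b' - b) / a) := by
    rw [hf, hg]; field_simp; ring
  rw [Function.comp_apply, this]
  exact Function.leftInverse_invFun hinj _

/-- Under the weak separation property, cylinder maps which are relatively close coincide. -/
lemma SatisfiesWSP.exists_eq_of_close (h : SatisfiesWSP S) :
    ∃ δ : ℝ, 0 < δ ∧ ∀ w₁ w₂ : List ι, w₁ ≠ [] → w₂ ≠ [] → ∀ a₁ b₁ a₂ b₂ : ℝ, a₁ ≠ 0 →
      (∀ x, wordMap S w₁ x = a₁ * x + b₁) → (∀ x, wordMap S w₂ x = a₂ * x + b₂) →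
      |a₂ - a₁| < δ * |a₁| → |b₂ - b₁| < δ * |a₁| → ∀ x, wordMap S w₁ x = wordMap S w₂ x := by
  let Φ : ℝ × ℝ → ℝ → ℝ := fun p x => p.1 * x + p.2
  have hΦ : Continuous Φ := by fun_prop
  have h1 : Φ (1, 0) = id := by funext x; simp [Φ]
  have hopen := (isClosed_closure.isOpen_compl.mem_nhds (show id ∈ (closure _)ᶜ from h))
  nth_rw 1 [← h1] at hopen
  have hnhds := hΦ.continuousAt.preimage_mem_nhds hopen
  obtain ⟨δ, hδ, hball⟩ := Metric.mem_nhds_iff.1 hnhds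
  refine ⟨δ, hδ, fun w₁ w₂ hw₁ hw₂ a₁ b₁ a₂ b₂ ha h₁ h₂ hclose₁ hclose₂ x => ?_⟩
  have hpos : 0 < |a₁| := abs_pos.2 ha
  by_cases hw : w₁ = w₂
  · rw [hw]
  have hmem : (a₂ / a₁, (b₂ - b₁) / a₁) ∈ Metric.ball ((1 : ℝ), (0 : ℝ)) δ := by
    rw [Metric.mem_ball, Prod.dist_eq, max_lt_iff, Real.dist_eq, Real.dist_eq]
    constructor
    · have : a₂ / a₁ - 1 = (a₂ - a₁) / a₁ := by field_simp
      rw [this, abs_div, div_lt_iff₀ hpos]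
      exact hclose₁
    · simp only [sub_zero]
      rw [abs_div, div_lt_iff₀ hpos]
      exact hclose₂
  have hcl := hball hmem
  have heq : Function.invFun (wordMap S w₁) ∘ wordMap S w₂ = Φ (a₂ / a₁, (b₂ - b₁) / a₁) :=
    funext fun x => invFun_comp_affine ha h₁ h₂ x
  have hid : Φ (a₂ / a₁, (b₂ - b₁) / a₁) = id := by
    by_contra hne
    exact hcl (subset_closure ⟨⟨w₁, w₂, hw₁, hw₂, hw, heq.symm⟩, hne⟩)
  have hx : a₂ / a₁ * x + (b₂ - b₁) / a₁ = x := congrFun hid x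
  rw [h₁, h₂]
  field_simp at hx
  linarith

/-- Under the weak separation property, the part of the attractor in a ball of radius `r` is
covered by a bounded number of cylinders of size less than `r`. -/
lemma SatisfiesWSP.exists_cover (h : SatisfiesWSP S) {F : Set ℝ} {m R : ℝ} (hm : 0 < m)
    (hR : ∀ x ∈ F, |x| ≤ R)
    (hword : ∀ p ∈ F, ∀ r : ℝ, 0 < r → r ≤ 1 →
      ∃ w : List ι, w ≠ [] ∧ ∃ q ∈ F, ∃ a b : ℝ, (∀ x, wordMap S w x = a * x + b) ∧
        p = a * q + b ∧ m * r ≤ |a| ∧ |a| < r) :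
    ∃ M : ℕ, ∀ x r : ℝ, 0 < r → r ≤ 1 → ∃ G : Finset (ℝ × ℝ), G.card ≤ M ∧
      (∀ g ∈ G, 0 < |g.1| ∧ |g.1| < r) ∧
      ∀ p ∈ F, dist p x < r → ∃ g ∈ G, ∃ q ∈ F, p = g.1 * q + g.2 := by
  classical
  obtain ⟨δ, hδ, hclose⟩ := h.exists_eq_of_close
  set η := δ * m with hη
  have hη0 : 0 < η := by positivity
  set N : ℤ := ⌈(1 + R) / η⌉ + 1 with hN
  let cells : Finset (ℤ × ℤ) := Finset.Icc (-N) N ×ˢ Finset.Icc (-N) N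
  refine ⟨cells.card, fun x r hr hr1 => ?_⟩
  let cell : ℝ × ℝ → ℤ × ℤ := fun g => (⌊g.1 / (η * r)⌋, ⌊(g.2 - x) / (η * r)⌋)
  let good : ℝ × ℝ → Prop := fun g => m * r ≤ |g.1| ∧ |g.1| < r ∧
    ∃ w : List ι, w ≠ [] ∧ ∀ y, wordMap S w y = g.1 * y + g.2
  have hex : ∀ k : ℤ × ℤ, ∃ g, (∃ g', good g' ∧ cell g' = k) → good g ∧ cell g = k := by
    intro k
    by_cases hk : ∃ g', good g' ∧ cell g' = k
    · obtain ⟨g, hg⟩ := hk; exact ⟨g, fun _ => hg⟩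
    · exact ⟨0, fun h => absurd h hk⟩
  choose pick hpick using hex
  refine ⟨(cells.filter fun k => ∃ g', good g' ∧ cell g' = k).image pick, ?_, ?_, ?_⟩
  · exact Finset.card_image_le.trans (Finset.card_filter_le _ _)
  · intro g hg
    obtain ⟨k, hk, rfl⟩ := Finset.mem_image.1 hg
    have := (hpick k (Finset.mem_filter.1 hk).2).1
    exact ⟨lt_of_lt_of_le (by positivity) this.1, this.2.1⟩
  · intro p hp hpx
    obtain ⟨w, hw, q, hq, a, b, hwab, hpq, ha1, ha2⟩ := hword p hp r hr hr1
    have hηr : 0 < η * r := by positivity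
    have hR0 : 0 ≤ R := (abs_nonneg q).trans (hR q hq)
    have hgood : good (a, b) := ⟨ha1, ha2, w, hw, hwab⟩
    have habs : ∀ y : ℝ, |y| ≤ (1 + R) * r → ⌊y / (η * r)⌋ ∈ Finset.Icc (-N) N := by
      intro y hy
      have h1 : |y / (η * r)| ≤ (1 + R) / η := by
        rw [abs_div, abs_of_pos hηr, div_le_div_iff₀ hηr hη0]
        calc |y| * η ≤ ((1 + R) * r) * η := by gcongr
          _ = _ := by ring
      have h2 := Int.le_ceil ((1 + R) / η)
      rw [abs_le] at h1
      rw [Finset.mem_Icc]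
      constructor
      · rw [Int.le_floor]; push_cast [hN]; linarith
      · have : ((⌊y / (η * r)⌋ : ℤ) : ℝ) ≤ N := by
          push_cast [hN]; linarith [Int.floor_le (y / (η * r))]
        exact_mod_cast this
    have hcell : cell (a, b) ∈ cells := by
      refine Finset.mem_product.2 ⟨habs _ ?_, habs _ ?_⟩
      · nlinarith
      · have h1 : b - x = (p - x) - a * q := by rw [hpq]; ring
        change |b - x| ≤ _
        rw [h1]
        rw [Real.dist_eq] at hpx
        calc |p - x - a * q| ≤ |p - x| + |a * q| := abs_sub _ _
          _ ≤ r + r * R := by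
            rw [abs_mul]
            have := hR q hq
            gcongr
          _ = _ := by ring
    have hhit : ∃ g', good g' ∧ cell g' = cell (a, b) := ⟨_, hgood, rfl⟩
    obtain ⟨⟨hg1, hg2, v, hv, hvg⟩, hgc⟩ := hpick _ hhit
    refine ⟨pick (cell (a, b)),
      Finset.mem_image_of_mem _ (Finset.mem_filter.2 ⟨hcell, hhit⟩), q, hq, ?_⟩
    set g := pick (cell (a, b)) with hgdef
    have hfl : ∀ y z : ℝ, ⌊y / (η * r)⌋ = ⌊z / (η * r)⌋ → |y - z| < δ * |a| := by
      intro y z hyz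
      have h1 := Int.abs_sub_lt_one_of_floor_eq_floor hyz
      rw [← sub_div, abs_div, abs_of_pos hηr, div_lt_one hηr] at h1
      calc |y - z| < η * r := h1
        _ = δ * (m * r) := by rw [hη]; ring
        _ ≤ _ := by gcongr
    have hc1 := hfl _ _ (congrArg Prod.fst hgc)
    have hc2 := hfl _ _ (congrArg Prod.snd hgc)
    have ha0 : a ≠ 0 := abs_pos.1 (lt_of_lt_of_le (by positivity) ha1)
    have := hclose w v hw hv a b g.1 g.2 ha0 hwab hvg hc1 (by simpa using hc2) q
    rw [hwab, hvg] at this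
    rw [hpq, this]

end IFS

/-- The covering condition with exponent `s` in the definition of the Assouad dimension. -/
def AssouadBound (A : Set ℝ) (s : ℝ) : Prop :=
  ∃ K : ℝ, 0 < K ∧ ∀ r ρ : ℝ, 0 < ρ → ρ < r → r ≤ 1 →
    ∀ x ∈ A, ∃ t : Finset ℝ, (A ∩ Metric.ball x r ⊆ ⋃ y ∈ t, Metric.ball y ρ) ∧
      (t.card : ℝ) ≤ K * (r / ρ) ^ s

lemma assouadBound_one (A : Set ℝ) : AssouadBound A 1 := by
  classical
  refine ⟨4, by norm_num, fun r ρ hρ hρr hr x _ => ?_⟩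
  refine ⟨(Finset.Icc ⌊(-r) / ρ⌋ ⌊r / ρ⌋).image fun k : ℤ => x + ρ * k + ρ / 2, ?_, ?_⟩
  · rintro p ⟨-, hp⟩
    rw [Metric.mem_ball, Real.dist_eq, abs_lt] at hp
    refine mem_iUnion₂.2 ⟨x + ρ * ⌊(p - x) / ρ⌋ + ρ / 2, Finset.mem_image.2
      ⟨⌊(p - x) / ρ⌋, Finset.mem_Icc.2 ⟨?_, ?_⟩, rfl⟩, ?_⟩
    · apply Int.floor_mono
      gcongr
      exact hp.1.le
    · apply Int.floor_mono
      gcongr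
      exact hp.2.le
    · have h1 := Int.floor_le ((p - x) / ρ)
      have h2 := Int.lt_floor_add_one ((p - x) / ρ)
      rw [le_div_iff₀ hρ] at h1
      rw [div_lt_iff₀ hρ] at h2
      rw [Metric.mem_ball, Real.dist_eq, abs_lt]
      constructor <;> linarith
  · have h1 : 1 < r / ρ := (one_lt_div hρ).2 hρr
    have h2 := Int.floor_le (r / ρ)
    have h3 := Int.lt_floor_add_one (-r / ρ)
    rw [neg_div] at h3
    rw [Real.rpow_one]
    refine (Nat.cast_le.2 Finset.card_image_le).trans ?_
    rw [Int.card_Icc, neg_div]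
    have h4 : (⌊-(r / ρ)⌋ : ℤ) ≤ ⌊r / ρ⌋ := Int.floor_mono (by linarith)
    have h5 : (((⌊r / ρ⌋ + 1 - ⌊-(r / ρ)⌋).toNat : ℤ) : ℝ) = ⌊r / ρ⌋ + 1 - ⌊-(r / ρ)⌋ := by
      rw [Int.toNat_of_nonneg (by linarith)]
      push_cast
      ring
    rw [Int.cast_natCast] at h5
    rw [h5]
    linarith

lemma AssouadBound.dimH_le {F : Set ℝ} (hF : IsCompact F) {s : ℝ} (hs : 0 ≤ s)
    (h : AssouadBound F s) : dimH F ≤ ENNReal.ofReal s := by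
  obtain ⟨K, hK, hcov⟩ := h
  obtain ⟨t, htF, htfin, ht⟩ := hF.totallyBounded.exists_subset (Metric.dist_mem_uniformity one_pos)
  have hsub : F ⊆ ⋃ x ∈ t, F ∩ Metric.ball x 1 := by
    intro p hp
    obtain ⟨x, hx, hpx⟩ := mem_iUnion₂.1 (ht hp)
    exact mem_iUnion₂.2 ⟨x, hx, hp, hpx⟩
  refine (dimH_mono hsub).trans ?_
  rw [dimH_bUnion htfin.countable]
  refine iSup₂_le fun x hx => ?_
  refine le_of_forall_gt_imp_ge_of_dense fun a ha => ?_
  obtain ⟨u, hu1, hu2⟩ := ENNReal.lt_iff_exists_nnreal_btwn.1 ha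
  refine le_trans ?_ hu2.le
  apply dimH_le_of_hausdorffMeasure_ne_top
  have hsu : s < u := by
    rwa [← ENNReal.ofReal_coe_nnreal, ENNReal.ofReal_lt_ofReal_iff_of_nonneg hs] at hu1
  let ρ : ℕ → ℝ := fun n => 1 / ((n : ℝ) + 2)
  have hρ : ∀ n, 0 < ρ n := fun n => by positivity
  have hρ1 : ∀ n, ρ n < 1 := fun n => by
    change 1 / ((n : ℝ) + 2) < 1
    rw [div_lt_one (by positivity)]
    have : (0 : ℝ) ≤ n := n.cast_nonneg
    linarith
  have hρ0 : Tendsto ρ atTop (nhds 0) := by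
    have := (tendsto_one_div_add_atTop_nhds_zero_nat (𝕜 := ℝ)).comp (tendsto_add_atTop_nat 1)
    refine this.congr fun n => ?_
    simp only [Function.comp_apply, ρ]
    push_cast
    ring
  choose T hT hTc using fun n => hcov 1 (ρ n) (hρ n) (hρ1 n) le_rfl x (htF hx)
  have hdiamball : ∀ (y : ℝ) n, Metric.ediam (Metric.ball y (ρ n)) = ENNReal.ofReal (2 * ρ n) := by
    intro y n
    rw [Real.ball_eq_Ioo, Real.ediam_Ioo]
    ring_nf
  have hle := Measure.hausdorffMeasure_le_liminf_sum (u : ℝ) (F ∩ Metric.ball x 1)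
    (l := atTop) (fun n => ENNReal.ofReal (2 * ρ n))
    (by simpa using ENNReal.tendsto_ofReal (hρ0.const_mul 2))
    (fun n (i : T n) => Metric.ball (i : ℝ) (ρ n))
    (Eventually.of_forall fun n i => by
      rw [hdiamball])
    (Eventually.of_forall fun n => by
      intro p hp
      obtain ⟨y, hy, hpy⟩ := mem_iUnion₂.1 (hT n hp)
      exact mem_iUnion.2 ⟨⟨y, hy⟩, hpy⟩)
  have hbound : ∀ n, ∑ i : T n, Metric.ediam (Metric.ball (i : ℝ) (ρ n)) ^ (u : ℝ) ≤
      ENNReal.ofReal (K * 2 ^ (u : ℝ)) := by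
    intro n
    simp only [hdiamball, Finset.sum_const, nsmul_eq_mul]
    rw [ENNReal.ofReal_rpow_of_pos (by have := hρ n; positivity), ← ENNReal.ofReal_natCast,
      ← ENNReal.ofReal_mul (by positivity)]
    apply ENNReal.ofReal_le_ofReal
    rw [Finset.card_univ, Fintype.card_coe, Real.mul_rpow (by norm_num) (hρ n).le]
    have h1 : ρ n ^ (u : ℝ) ≤ ρ n ^ s :=
      Real.rpow_le_rpow_of_exponent_ge (hρ n) (hρ1 n).le hsu.le
    have h2 : (1 / ρ n) ^ s * ρ n ^ s = 1 := by
      rw [← Real.mul_rpow (by have := hρ n; positivity) (hρ n).le, one_div,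
        inv_mul_cancel₀ (hρ n).ne', Real.one_rpow]
    have hρs := Real.rpow_nonneg (hρ n).le s
    calc ((T n).card : ℝ) * (2 ^ (u : ℝ) * ρ n ^ (u : ℝ))
        ≤ (K * (1 / ρ n) ^ s) * (2 ^ (u : ℝ) * ρ n ^ s) := by
          gcongr
          exact hTc n
      _ = K * 2 ^ (u : ℝ) * ((1 / ρ n) ^ s * ρ n ^ s) := by ring
      _ = _ := by rw [h2, mul_one]
  refine ne_top_of_le_ne_top (ENNReal.ofReal_ne_top (r := K * 2 ^ (u : ℝ))) (hle.trans ?_)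
  refine (liminf_le_liminf (Eventually.of_forall hbound)).trans ?_
  simp

/-- A compact set of Hausdorff dimension less than `s` has finite covers by balls whose radii have
arbitrarily small `s`-power sum. -/
lemma exists_finite_cover_sum_rpow_le {F : Set ℝ} (hF : IsCompact F) {s : ℝ} (hs : 0 < s)
    (hdim : dimH F < ENNReal.ofReal s) {ε : ℝ} (hε : 0 < ε) :
    ∃ (J : Finset ℕ) (x r : ℕ → ℝ), (∀ j ∈ J, 0 < r j) ∧
      F ⊆ ⋃ j ∈ J, Metric.ball (x j) (r j) ∧ ∑ j ∈ J, r j ^ s ≤ ε := by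
  have hzero : μH[s] F = 0 := by
    have := hausdorffMeasure_of_dimH_lt (d := s.toNNReal) hdim
    rwa [Real.coe_toNNReal s hs.le] at this
  rw [Measure.hausdorffMeasure_apply] at hzero
  have hε2 : 0 < ENNReal.ofReal (ε / 2) := ENNReal.ofReal_pos.2 (by positivity)
  have h1 : _ < ENNReal.ofReal (ε / 2) :=
    ((le_iSup₂ (α := ENNReal) (1 : ENNReal) one_pos).trans hzero.le).trans_lt hε2
  simp only [iInf_lt_iff] at h1
  obtain ⟨t, ht, htd, hsum⟩ := h1
  obtain ⟨e, he, hesum⟩ := ENNReal.exists_pos_sum_of_countable hε2.ne' ℕ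
  have hdiam : ∀ n, (⨆ _ : (t n).Nonempty, Metric.ediam (t n) ^ s) = Metric.ediam (t n) ^ s := by
    intro n
    rcases (t n).eq_empty_or_nonempty with h | h
    · simp [h, hs]
    · simp [h]
  simp only [hdiam] at hsum
  let v : ℕ → ENNReal := fun n => Metric.ediam (t n) ^ s + e n
  have hd : ∀ n, Metric.ediam (t n) ^ s ≠ ⊤ := fun n =>
    ENNReal.rpow_ne_top_of_nonneg hs.le (ne_top_of_le_ne_top ENNReal.one_ne_top (htd n))
  have hv : ∀ n, v n ≠ ⊤ := fun n => ENNReal.add_ne_top.2 ⟨hd n, ENNReal.coe_ne_top⟩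
  have hv0 : ∀ n, 0 < v n := fun n =>
    lt_of_lt_of_le (ENNReal.coe_pos.2 (he n)) le_add_self
  have hvlt : ∀ n, Metric.ediam (t n) ^ s < v n := fun n =>
    ENNReal.lt_add_right (hd n) (ENNReal.coe_pos.2 (he n)).ne'
  let r : ℕ → ℝ := fun n => (v n).toReal ^ (1 / s)
  have hr : ∀ n, 0 < r n := fun n =>
    Real.rpow_pos_of_pos (ENNReal.toReal_pos (hv0 n).ne' (hv n)) _
  have hrs : ∀ n, r n ^ s = (v n).toReal := fun n => by
    simp only [r]
    rw [← Real.rpow_mul ENNReal.toReal_nonneg, one_div, inv_mul_cancel₀ hs.ne', Real.rpow_one]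
  have hcen : ∀ n, ∃ x, ∀ y ∈ t n, y ∈ Metric.ball x (r n) := by
    intro n
    rcases (t n).eq_empty_or_nonempty with h | ⟨x, hx⟩
    · exact ⟨0, by simp [h]⟩
    · refine ⟨x, fun y hy => ?_⟩
      rw [Metric.mem_ball, ← Real.rpow_lt_rpow_iff dist_nonneg (hr n).le hs, hrs,
        dist_edist, ENNReal.toReal_rpow]
      refine (ENNReal.toReal_lt_toReal ?_ (hv n)).2 (lt_of_le_of_lt ?_ (hvlt n))
      · exact ENNReal.rpow_ne_top_of_nonneg hs.le (edist_ne_top _ _)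
      · exact ENNReal.rpow_le_rpow (Metric.edist_le_ediam_of_mem hy hx) hs.le
  choose x hx using hcen
  obtain ⟨J, hJ⟩ := hF.elim_finite_subcover (fun n => Metric.ball (x n) (r n))
    (fun n => Metric.isOpen_ball) (fun p hp => by
      obtain ⟨n, hn⟩ := mem_iUnion.1 (ht hp)
      exact mem_iUnion.2 ⟨n, hx n p hn⟩)
  refine ⟨J, x, r, fun j _ => hr j, hJ, ?_⟩
  simp only [hrs]
  rw [← ENNReal.toReal_sum fun n _ => hv n]
  apply ENNReal.toReal_le_of_le_ofReal hε.le
  calc ∑ n ∈ J, v n ≤ ∑' n, v n := ENNReal.sum_le_tsum J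
    _ = ∑' n, Metric.ediam (t n) ^ s + ∑' n, (e n : ENNReal) := ENNReal.tsum_add
    _ ≤ ENNReal.ofReal (ε / 2) + ENNReal.ofReal (ε / 2) := add_le_add hsum.le hesum.le
    _ = ENNReal.ofReal ε := by
      rw [← ENNReal.ofReal_add (by positivity) (by positivity), add_halves]

lemma exists_affine_image_cover [DecidableEq ℝ] {F P : Set ℝ} {a b ρ : ℝ} (ha : 0 < |a|)
    (hP : ∀ p ∈ P, ∃ q ∈ F, p = a * q + b) {t : Finset ℝ}
    (ht : F ⊆ ⋃ y ∈ t, Metric.ball y (ρ / |a|)) :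
    P ⊆ ⋃ y ∈ t.image fun y => a * y + b, Metric.ball y ρ := by
  intro p hp
  obtain ⟨q, hq, rfl⟩ := hP p hp
  obtain ⟨y, hy, hqy⟩ := mem_iUnion₂.1 (ht hq)
  refine mem_iUnion₂.2 ⟨a * y + b, Finset.mem_image_of_mem _ hy, ?_⟩
  rw [Metric.mem_ball, Real.dist_eq, lt_div_iff₀ ha] at hqy
  rw [Metric.mem_ball, Real.dist_eq]
  calc |a * q + b - (a * y + b)| = |q - y| * |a| := by rw [← abs_mul]; ring_nf
    _ < ρ := hqy

lemma exists_card_cover_le {κ : Type*} (A : Finset κ) (a b : κ → ℝ) {s : ℝ} (hs : 0 ≤ s)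
    (ha : ∀ k ∈ A, 0 < |a k| ∧ |a k| < 1) (hsum : ∑ k ∈ A, |a k| ^ s ≤ 1)
    {F : Set ℝ} (hF : IsCompact F) (hcov : ∀ p ∈ F, ∃ k ∈ A, ∃ q ∈ F, p = a k * q + b k) :
    ∃ K : ℝ, 0 < K ∧ ∀ ρ : ℝ, 0 < ρ → ρ ≤ 1 → ∃ t : Finset ℝ,
      F ⊆ ⋃ y ∈ t, Metric.ball y ρ ∧ (t.card : ℝ) ≤ K * ρ ^ (-s) := by
  classical
  rcases A.eq_empty_or_nonempty with rfl | hA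
  · refine ⟨1, one_pos, fun ρ hρ _ => ⟨∅, fun p hp => ?_, ?_⟩⟩
    · obtain ⟨k, hk, _⟩ := hcov p hp
      simp at hk
    · simpa using Real.rpow_nonneg hρ.le _
  obtain ⟨k₀, hk₀, hmin⟩ := A.exists_min_image (fun k => |a k|) hA
  obtain ⟨k₁, hk₁, hmax⟩ := A.exists_max_image (fun k => |a k|) hA
  set m := |a k₀| with hm
  set M := |a k₁| with hM
  obtain ⟨hm0, hm1⟩ := ha k₀ hk₀
  obtain ⟨hM0, hM1⟩ := ha k₁ hk₁
  obtain ⟨t₀, ht₀⟩ : ∃ t : Finset ℝ, F ⊆ ⋃ y ∈ t, Metric.ball y m := by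
    obtain ⟨t, -, htfin, ht⟩ := hF.totallyBounded.exists_subset (Metric.dist_mem_uniformity hm0)
    refine ⟨htfin.toFinset, fun p hp => ?_⟩
    obtain ⟨x, hx, hpx⟩ := mem_iUnion₂.1 (ht hp)
    exact mem_iUnion₂.2 ⟨x, htfin.mem_toFinset.2 hx, hpx⟩
  set K : ℝ := ((t₀.card : ℝ) + 1) * (1 / m) ^ s with hK
  have hK0 : 0 < K := by positivity
  have base : ∀ ρ, m ≤ ρ → ρ ≤ 1 / m → ∃ t : Finset ℝ,
      F ⊆ ⋃ y ∈ t, Metric.ball y ρ ∧ (t.card : ℝ) ≤ K * ρ ^ (-s) := by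
    intro ρ h1 h2
    have hρ : 0 < ρ := hm0.trans_le h1
    refine ⟨t₀, ht₀.trans (iUnion₂_mono fun y _ => Metric.ball_subset_ball h1), ?_⟩
    have h3 : ρ ^ s ≤ (1 / m) ^ s := Real.rpow_le_rpow hρ.le h2 hs
    rw [Real.rpow_neg hρ.le, ← div_eq_mul_inv, le_div_iff₀ (Real.rpow_pos_of_pos hρ _), hK]
    gcongr
    linarith
  have key : ∀ n : ℕ, ∀ ρ, m * M ^ n ≤ ρ → ρ ≤ 1 / m → ∃ t : Finset ℝ,
      F ⊆ ⋃ y ∈ t, Metric.ball y ρ ∧ (t.card : ℝ) ≤ K * ρ ^ (-s) := by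
    intro n
    induction n with
    | zero => intro ρ h1 h2; exact base ρ (by simpa using h1) h2
    | succ n ih =>
      intro ρ h1 h2
      by_cases hmρ : m ≤ ρ
      · exact base ρ hmρ h2
      push Not at hmρ
      have hρ : 0 < ρ := lt_of_lt_of_le (by positivity) h1
      have hex : ∀ k, ∃ t : Finset ℝ, k ∈ A → F ⊆ ⋃ y ∈ t, Metric.ball y (ρ / |a k|) ∧
          (t.card : ℝ) ≤ K * (ρ / |a k|) ^ (-s) := by
        intro k
        by_cases hk : k ∈ A
        · obtain ⟨hk0, -⟩ := ha k hk
          obtain ⟨t, ht⟩ := ih (ρ / |a k|)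
            (by
              rw [le_div_iff₀ hk0]
              calc m * M ^ n * |a k| ≤ m * M ^ n * M := by gcongr; exact hmax k hk
                _ = m * M ^ (n + 1) := by ring
                _ ≤ ρ := h1)
            (by
              rw [div_le_div_iff₀ hk0 hm0]
              calc ρ * m ≤ m * 1 := by rw [mul_comm]; gcongr; linarith
                _ ≤ 1 * |a k| := by simpa using hmin k hk)
          exact ⟨t, fun _ => ht⟩
        · exact ⟨∅, fun h => absurd h hk⟩
      choose t ht using hex
      refine ⟨A.biUnion fun k => (t k).image fun y => a k * y + b k, fun p hp => ?_, ?_⟩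
      · obtain ⟨k, hk, q, hq, hpq⟩ := hcov p hp
        have := exists_affine_image_cover (P := {p}) (ha k hk).1
          (fun p' hp' => ⟨q, hq, (mem_singleton_iff.1 hp').trans hpq⟩) (ht k hk).1
        obtain ⟨y, hy, hpy⟩ := mem_iUnion₂.1 (this (mem_singleton p))
        exact mem_iUnion₂.2 ⟨y, Finset.mem_biUnion.2 ⟨k, hk, hy⟩, hpy⟩
      · calc ((A.biUnion fun k => (t k).image fun y => a k * y + b k).card : ℝ)
            ≤ ((∑ k ∈ A, (t k).card : ℕ) : ℝ) := by
              exact_mod_cast Finset.card_biUnion_le.trans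
                (Finset.sum_le_sum fun k _ => Finset.card_image_le)
          _ = ∑ k ∈ A, ((t k).card : ℝ) := by push_cast; rfl
          _ ≤ ∑ k ∈ A, K * ρ ^ (-s) * |a k| ^ s := by
              refine Finset.sum_le_sum fun k hk => (ht k hk).2.trans_eq ?_
              rw [Real.div_rpow hρ.le (abs_nonneg _), Real.rpow_neg (abs_nonneg (a k)),
                div_inv_eq_mul]
              ring
          _ = K * ρ ^ (-s) * ∑ k ∈ A, |a k| ^ s := by rw [Finset.mul_sum]
          _ ≤ K * ρ ^ (-s) * 1 := by
              have := Real.rpow_nonneg hρ.le (-s)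
              gcongr
          _ = _ := mul_one _
  refine ⟨K, hK0, fun ρ hρ hρ1 => ?_⟩
  obtain ⟨n, hn⟩ := exists_pow_lt_of_lt_one (div_pos hρ hm0) hM1
  refine key n ρ ?_ (hρ1.trans ?_)
  · rw [lt_div_iff₀ hm0] at hn
    linarith
  · rw [le_div_iff₀ hm0]; linarith

/-- If the part of a compact set in any ball of radius `r` is covered by a bounded number of
affine copies of the set of ratio less than `r`, then its Assouad dimension is at most its
Hausdorff dimension. -/
lemma assouadBound_of_exists_cover {F : Set ℝ} (hF : IsCompact F) {M : ℕ}
    (hM : ∀ x r : ℝ, 0 < r → r ≤ 1 → ∃ G : Finset (ℝ × ℝ), G.card ≤ M ∧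
      (∀ g ∈ G, 0 < |g.1| ∧ |g.1| < r) ∧
      ∀ p ∈ F, dist p x < r → ∃ g ∈ G, ∃ q ∈ F, p = g.1 * q + g.2)
    {s : ℝ} (hs : 0 < s) (hdim : dimH F < ENNReal.ofReal s) : AssouadBound F s := by
  classical
  obtain ⟨J, x, r, hr, hcov, hsum⟩ := exists_finite_cover_sum_rpow_le hF hs hdim
    (ε := 1 / (M + 1)) (by positivity)
  have hr1 : ∀ j ∈ J, r j ≤ 1 := by
    intro j hj
    have h1 : r j ^ s ≤ 1 := by
      refine (Finset.single_le_sum (f := fun j => r j ^ s)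
        (fun i hi => Real.rpow_nonneg (hr i hi).le s) hj).trans (hsum.trans ?_)
      rw [div_le_one (by positivity)]
      linarith [M.cast_nonneg (α := ℝ)]
    by_contra h2
    push Not at h2
    exact absurd h1 (not_le.2 (Real.one_lt_rpow h2 hs))
  have hex : ∀ j, ∃ G : Finset (ℝ × ℝ), j ∈ J → G.card ≤ M ∧
      (∀ g ∈ G, 0 < |g.1| ∧ |g.1| < r j) ∧
      ∀ p ∈ F, dist p (x j) < r j → ∃ g ∈ G, ∃ q ∈ F, p = g.1 * q + g.2 := by
    intro j
    by_cases hj : j ∈ J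
    · obtain ⟨G, hG⟩ := hM (x j) (r j) (hr j hj) (hr1 j hj)
      exact ⟨G, fun _ => hG⟩
    · exact ⟨∅, fun h => absurd h hj⟩
  choose G hG using hex
  obtain ⟨K, hK, hcard⟩ := exists_card_cover_le (J.sigma G) (fun k => k.2.1) (fun k => k.2.2) hs.le
    (fun k hk => by
      obtain ⟨hj, hg⟩ := Finset.mem_sigma.1 hk
      obtain ⟨h1, h2⟩ := (hG k.1 hj).2.1 k.2 hg
      exact ⟨h1, h2.trans_le (hr1 _ hj)⟩)
    (by
      rw [Finset.sum_sigma]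
      calc ∑ j ∈ J, ∑ g ∈ G j, |g.1| ^ s ≤ ∑ j ∈ J, (M : ℝ) * r j ^ s := by
            refine Finset.sum_le_sum fun j hj => ?_
            calc ∑ g ∈ G j, |g.1| ^ s ≤ ∑ g ∈ G j, r j ^ s :=
                  Finset.sum_le_sum fun g hg =>
                    Real.rpow_le_rpow (abs_nonneg _) ((hG j hj).2.1 g hg).2.le hs.le
              _ = (G j).card * r j ^ s := by rw [Finset.sum_const, nsmul_eq_mul]
              _ ≤ M * r j ^ s := by
                have := Real.rpow_nonneg (hr j hj).le s
                gcongr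
                exact (hG j hj).1
        _ = M * ∑ j ∈ J, r j ^ s := by rw [Finset.mul_sum]
        _ ≤ M * (1 / (M + 1)) := by gcongr
        _ ≤ 1 := by
          rw [mul_one_div, div_le_one (by positivity)]
          linarith)
    hF
    (fun p hp => by
      obtain ⟨j, hj, hpj⟩ := mem_iUnion₂.1 (hcov hp)
      obtain ⟨g, hg, q, hq, hpq⟩ := (hG j hj).2.2 p hp hpj
      exact ⟨⟨j, g⟩, Finset.mem_sigma.2 ⟨hj, hg⟩, q, hq, hpq⟩)
  refine ⟨(M + 1) * K, by positivity, fun r' ρ hρ hρr hr' y _ => ?_⟩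
  have hr0 : 0 < r' := hρ.trans hρr
  obtain ⟨G', hG'c, hG'r, hG'⟩ := hM y r' hr0 hr'
  obtain ⟨t, ht, htc⟩ := hcard (ρ / r') (by positivity) ((div_le_one hr0).2 hρr.le)
  refine ⟨G'.biUnion fun g => t.image fun y => g.1 * y + g.2, ?_, ?_⟩
  · rintro p ⟨hp, hpy⟩
    obtain ⟨g, hg, q, hq, hpq⟩ := hG' p hp hpy
    obtain ⟨hg0, hg1⟩ := hG'r g hg
    have hle : ρ / r' ≤ ρ / |g.1| := by gcongr
    have := exists_affine_image_cover (P := {p}) hg0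
      (fun p' hp' => ⟨q, hq, (mem_singleton_iff.1 hp').trans hpq⟩)
      (ht.trans (iUnion₂_mono fun y _ => Metric.ball_subset_ball hle))
    obtain ⟨z, hz, hpz⟩ := mem_iUnion₂.1 (this (mem_singleton p))
    exact mem_iUnion₂.2 ⟨z, Finset.mem_biUnion.2 ⟨g, hg, hz⟩, hpz⟩
  · have h1 : (G'.biUnion fun g => t.image fun y => g.1 * y + g.2).card ≤ M * t.card :=
      (Finset.card_biUnion_le_card_mul _ _ _ fun g _ => Finset.card_image_le).trans
        (Nat.mul_le_mul_right _ hG'c)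
    have h2 : (ρ / r') ^ (-s) = (r' / ρ) ^ s := by
      rw [Real.rpow_neg (by positivity), ← Real.inv_rpow (by positivity), inv_div]
    rw [h2] at htc
    have h3 : 0 ≤ K * (r' / ρ) ^ s := by positivity
    calc _ ≤ ((M * t.card : ℕ) : ℝ) := by exact_mod_cast h1
      _ = M * (t.card : ℝ) := by push_cast; rfl
      _ ≤ (M + 1) * (K * (r' / ρ) ^ s) := by gcongr; linarith
      _ = _ := by ring

section NotWSP

variable {ι : Type} {S : ι → ℝ → ℝ}

/-- When the weak separation property fails, there are pairs of cylinder maps which differ by an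
almost-translation of any prescribed approximate size. -/
lemma exists_displacement_of_not_satisfiesWSP (h : ¬ SatisfiesWSP S)
    (hS : ∀ i, ∃ a b : ℝ, 0 < |a| ∧ |a| < 1 ∧ ∀ x, S i x = a * x + b)
    {F : Set ℝ} (hFnt : F.Nontrivial) {m R : ℝ} (hm : 0 < m) (hm1 : m < 1)
    (hR : ∀ x ∈ F, |x| ≤ R)
    (hword : ∀ p ∈ F, ∀ r : ℝ, 0 < r → r ≤ 1 →
      ∃ w : List ι, w ≠ [] ∧ ∃ q ∈ F, ∃ a b : ℝ, (∀ x, wordMap S w x = a * x + b) ∧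
        p = a * q + b ∧ m * r ≤ |a| ∧ |a| < r) {d : ℝ} (hd : 0 < d) :
    ∃ (w₁ w₂ : List ι) (g : ℝ → ℝ), (∀ x, wordMap S w₂ x = wordMap S w₁ (g x)) ∧
      ((∀ x ∈ F, d / 4 ≤ g x - x ∧ g x - x ≤ d / m) ∨
        ∀ x ∈ F, d / 4 ≤ x - g x ∧ x - g x ≤ d / m) := by
  obtain ⟨p₁, hp₁, p₂, hp₂, hp₁₂⟩ := hFnt
  have hR0 : 0 ≤ R := (abs_nonneg _).trans (hR _ hp₁)
  set τ := d / (16 * (R + 1)) with hτ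
  have hτ0 : 0 < τ := by positivity
  have hτR : τ * R + τ = d / 16 := by rw [hτ]; field_simp
  have hτR0 : 0 ≤ τ * R := by positivity
  have hcl : id ∈ closure ({g : ℝ → ℝ | ∃ w₁ w₂ : List ι, w₁ ≠ [] ∧ w₂ ≠ [] ∧ w₁ ≠ w₂ ∧
      g = Function.invFun (wordMap S w₁) ∘ wordMap S w₂} \ {id}) := not_not.1 h
  have hopen : IsOpen {f : ℝ → ℝ | |f 0| < τ ∧ |f 1 - 1| < τ} := by
    apply IsOpen.inter
    · exact isOpen_lt (f := fun f : ℝ → ℝ => |f 0|) (by fun_prop) continuous_const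
    · exact isOpen_lt (f := fun f : ℝ → ℝ => |f 1 - 1|) (by fun_prop) continuous_const
  obtain ⟨g, ⟨hg0, hg1⟩, ⟨w₁, w₂, -, -, -, hg⟩, hgid⟩ :=
    mem_closure_iff.1 hcl _ hopen (by simpa using hτ0)
  obtain ⟨a₁, b₁, ha₁, -, h₁⟩ := wordMap_affine hS w₁
  obtain ⟨a₂, b₂, -, -, h₂⟩ := wordMap_affine hS w₂
  have ha₁0 : a₁ ≠ 0 := abs_pos.1 ha₁
  set a := a₂ / a₁ with ha
  set b := (b₂ - b₁) / a₁ with hb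
  have hgab : ∀ x, g x = a * x + b := by
    intro x
    rw [hg]
    exact invFun_comp_affine ha₁0 h₁ h₂ x
  have hb0 : |b| < τ := by simpa [hgab] using hg0
  have ha0 : |a - 1| ≤ 2 * τ := by
    have h3 : a - 1 = (g 1 - 1) - b := by rw [hgab]; ring
    rw [h3]
    exact (abs_sub _ _).trans (by linarith)
  obtain ⟨p, hp, hpne⟩ : ∃ p ∈ F, (a - 1) * p + b ≠ 0 := by
    by_contra hall
    push Not at hall
    have e1 := hall p₁ hp₁
    have e2 := hall p₂ hp₂
    have e3 : (a - 1) * (p₁ - p₂) = 0 := by linear_combination e1 - e2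
    have ha1 : a - 1 = 0 := (mul_eq_zero.1 e3).resolve_right (sub_ne_zero.2 hp₁₂)
    have hb1 : b = 0 := by simpa [ha1] using e1
    apply hgid
    rw [mem_singleton_iff]
    funext x
    rw [hgab, hb1, sub_eq_zero.1 ha1, id]
    ring
  set φ := (a - 1) * p + b with hφ
  have hφ0 : 0 < |φ| := abs_pos.2 hpne
  have hφ1 : |φ| ≤ d / 2 := by
    have h3 : |(a - 1) * p| ≤ 2 * τ * R := by
      rw [abs_mul]
      exact mul_le_mul ha0 (hR p hp) (abs_nonneg _) (by positivity)
    have h4 : |φ| ≤ |(a - 1) * p| + |b| := abs_add_le _ _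
    nlinarith
  obtain ⟨v, -, q, hq, A, t, hv, hpq, hA1, hA2⟩ := hword p hp (|φ| / (d / 2)) (by positivity)
    ((div_le_one (by positivity)).2 hφ1)
  have hA0 : 0 < |A| := lt_of_lt_of_le (by positivity) hA1
  have hAne : A ≠ 0 := abs_pos.1 hA0
  have hψ1 : d / 2 < |φ / A| := by
    rw [abs_div, lt_div_iff₀ hA0]
    rw [lt_div_iff₀ (by positivity)] at hA2
    linarith
  have hψ2 : |φ / A| ≤ d / (2 * m) := by
    rw [abs_div, div_le_div_iff₀ hA0 (by positivity)]
    rw [mul_div_assoc', div_le_iff₀ (by positivity)] at hA1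
    linarith
  have hdm : d / (2 * m) + d / 4 ≤ d / m := by
    have h3 : d / m = d / (2 * m) + d / (2 * m) := by field_simp; norm_num
    have h4 : d / 4 ≤ d / (2 * m) := by gcongr; linarith
    linarith
  let g' : ℝ → ℝ := fun x => a * x + ((a - 1) * t + b) / A
  have hg' : ∀ x, g' x - x = φ / A + (a - 1) * (x - q) := by
    intro x
    simp only [g', hφ, hpq]
    field_simp
    ring
  have herr : ∀ x ∈ F, |(a - 1) * (x - q)| ≤ d / 4 := by
    intro x hx
    rw [abs_mul]
    have h3 : |x - q| ≤ 2 * R := (abs_sub _ _).trans (by linarith [hR x hx, hR q hq])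
    have h4 : |a - 1| * |x - q| ≤ 2 * τ * (2 * R) :=
      mul_le_mul ha0 h3 (abs_nonneg _) (by positivity)
    linarith
  refine ⟨w₁ ++ v, w₂ ++ v, g', fun x => ?_, ?_⟩
  · simp only [wordMap_append, Function.comp_apply, h₁, h₂, hv, g']
    simp only [ha, hb]
    field_simp
    ring
  · rcases le_total 0 (φ / A) with hs | hs
    · left
      intro x hx
      have h3 := abs_le.1 (herr x hx)
      rw [abs_of_nonneg hs] at hψ1 hψ2
      rw [hg']
      constructor <;> linarith
    · right
      intro x hx
      have h3 := abs_le.1 (herr x hx)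
      rw [abs_of_nonpos hs] at hψ1 hψ2
      have h4 := hg' x
      constructor <;> linarith

/-- A set closed under pairs of maps differing by almost-translations of every size contains
arbitrarily long approximate arithmetic progressions. -/
lemma exists_approximate_progression {F : Set ℝ} (hFne : F.Nonempty)
    {m : ℝ} (hm : 0 < m)
    (hdisp : ∀ d : ℝ, 0 < d → ∃ (f g : ℝ → ℝ) (a b : ℝ), 0 < |a| ∧ |a| ≤ 1 ∧
      (∀ x, f x = a * x + b) ∧ (∀ x ∈ F, f x ∈ F) ∧ (∀ x ∈ F, f (g x) ∈ F) ∧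
      ((∀ x ∈ F, d / 4 ≤ g x - x ∧ g x - x ≤ d / m) ∨
        ∀ x ∈ F, d / 4 ≤ x - g x ∧ x - g x ≤ d / m)) (n : ℕ) {ε : ℝ} (hε : 0 < ε) :
    ∃ d : ℝ, 0 < d ∧ d ≤ ε ∧ ∃ P : Finset ℝ, (P : Set ℝ) ⊆ F ∧ P.card = n + 1 ∧
      ∀ x ∈ P, ∀ y ∈ P, |x - y| ≤ n * (d / m) ∧ (x ≠ y → d / 4 ≤ |x - y|) := by
  classical
  induction n with
  | zero =>
    obtain ⟨p, hp⟩ := hFne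
    exact ⟨ε, hε, le_rfl, {p}, by simpa using hp, by simp, by simp⟩
  | succ n ih =>
    obtain ⟨d, hd, hdε, P, hPF, hcard, hP⟩ := ih
    obtain ⟨f, g, a, b, ha0, ha1, hf, hfF, hfgF, hg⟩ := hdisp d hd
    have hPne : P.Nonempty := Finset.card_pos.1 (by omega)
    obtain ⟨x₀, hx₀, hz⟩ : ∃ x₀ ∈ P, ∀ y ∈ P, d / 4 ≤ |g x₀ - y| ∧
        |g x₀ - y| ≤ ((n + 1 : ℕ) : ℝ) * (d / m) := by
      push_cast
      rcases hg with hg | hg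
      · obtain ⟨x₀, hx₀, hmax⟩ := P.exists_max_image id hPne
        refine ⟨x₀, hx₀, fun y hy => ?_⟩
        have h1 := hg x₀ (hPF hx₀)
        have h2 := hmax y hy
        have h3 := (abs_le.1 (hP x₀ hx₀ y hy).1).2
        simp only [id] at h2
        rw [abs_of_nonneg (by linarith)]
        constructor <;> linarith
      · obtain ⟨x₀, hx₀, hmin⟩ := P.exists_min_image id hPne
        refine ⟨x₀, hx₀, fun y hy => ?_⟩
        have h1 := hg x₀ (hPF hx₀)
        have h2 := hmin y hy
        have h3 := (abs_le.1 (hP x₀ hx₀ y hy).1).1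
        simp only [id] at h2
        rw [abs_of_nonpos (by linarith)]
        constructor <;> linarith
    have hane : a ≠ 0 := abs_pos.1 ha0
    have hinj : Function.Injective f := fun x y hxy => by
      rw [hf, hf] at hxy
      exact mul_left_cancel₀ hane (add_right_cancel hxy)
    have hzP : g x₀ ∉ P := fun hmem => by
      have := (hz _ hmem).1
      rw [sub_self, abs_zero] at this
      linarith
    have hQ : ∀ x ∈ insert (g x₀) P, ∀ y ∈ insert (g x₀) P,
        |x - y| ≤ ((n + 1 : ℕ) : ℝ) * (d / m) ∧ (x ≠ y → d / 4 ≤ |x - y|) := by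
      have hdm : 0 ≤ d / m := by positivity
      intro x hx y hy
      rcases Finset.mem_insert.1 hx with rfl | hx <;> rcases Finset.mem_insert.1 hy with rfl | hy
      · simp only [sub_self, abs_zero, ne_eq, not_true_eq_false, false_imp_iff, and_true]
        positivity
      · exact ⟨(hz y hy).2, fun _ => (hz y hy).1⟩
      · rw [abs_sub_comm]
        exact ⟨(hz x hx).2, fun _ => (hz x hx).1⟩
      · refine ⟨(hP x hx y hy).1.trans ?_, (hP x hx y hy).2⟩
        push_cast
        linarith
    refine ⟨|a| * d, by positivity, (mul_le_of_le_one_left hd.le ha1).trans hdε,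
      (insert (g x₀) P).image f, ?_, ?_, ?_⟩
    · intro y hy
      obtain ⟨x, hx, rfl⟩ := Finset.mem_image.1 (Finset.mem_coe.1 hy)
      rcases Finset.mem_insert.1 hx with rfl | hx
      · exact hfgF x₀ (hPF hx₀)
      · exact hfF x (hPF hx)
    · rw [Finset.card_image_of_injective _ hinj, Finset.card_insert_of_notMem hzP, hcard]
    · intro x' hx' y' hy'
      obtain ⟨x, hx, rfl⟩ := Finset.mem_image.1 hx'
      obtain ⟨y, hy, rfl⟩ := Finset.mem_image.1 hy'
      obtain ⟨h1, h2⟩ := hQ x hx y hy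
      have h3 : |f x - f y| = |a| * |x - y| := by rw [hf, hf, ← abs_mul]; ring_nf
      rw [h3]
      constructor
      · calc |a| * |x - y| ≤ |a| * (((n + 1 : ℕ) : ℝ) * (d / m)) := by gcongr
          _ = _ := by ring
      · intro hxy
        have h4 := h2 fun e => hxy (congrArg f e)
        calc |a| * d / 4 = |a| * (d / 4) := by ring
          _ ≤ _ := by gcongr

lemma AssouadBound.one_le_of_approximate_progression {F : Set ℝ} {m : ℝ} (hm : 0 < m) (hm1 : m < 1)
    (hprog : ∀ (n : ℕ) (ε : ℝ), 0 < ε →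
      ∃ d : ℝ, 0 < d ∧ d ≤ ε ∧ ∃ P : Finset ℝ, (P : Set ℝ) ⊆ F ∧ P.card = n + 1 ∧
        ∀ x ∈ P, ∀ y ∈ P, |x - y| ≤ n * (d / m) ∧ (x ≠ y → d / 4 ≤ |x - y|))
    {s : ℝ} (h : AssouadBound F s) : 1 ≤ s := by
  by_contra hs
  push Not at hs
  obtain ⟨K, hK, hcov⟩ := h
  have hbound : ∀ n : ℕ, ((n + 1 : ℕ) : ℝ) ^ (1 - s) ≤ K * (8 / m) ^ s := by
    intro n
    obtain ⟨d, hd, hdε, P, hPF, hcard, hP⟩ := hprog n (m / (n + 1)) (by positivity)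
    have hPne : P.Nonempty := Finset.card_pos.1 (by omega)
    obtain ⟨x, hx⟩ := hPne
    have hn : (0 : ℝ) ≤ n := n.cast_nonneg
    have hdm : d < d / m := by rw [lt_div_iff₀ hm]; nlinarith
    have hdm0 : 0 < d / m := by positivity
    obtain ⟨t, ht, htc⟩ := hcov ((n + 1) * (d / m)) (d / 8) (by positivity) (by nlinarith)
      (by
        rw [le_div_iff₀ (by positivity)] at hdε
        rw [mul_div_assoc', div_le_one hm]
        linarith) x (hPF hx)
    have hball : ∀ y ∈ P, ∃ z ∈ t, y ∈ Metric.ball z (d / 8) := by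
      intro y hy
      have : y ∈ ⋃ z ∈ t, Metric.ball z (d / 8) := by
        refine ht ⟨hPF hy, ?_⟩
        rw [Metric.mem_ball, Real.dist_eq]
        have := (hP y hy x hx).1
        linarith
      obtain ⟨z, hz, hyz⟩ := mem_iUnion₂.1 this
      exact ⟨z, hz, hyz⟩
    choose! z hzt hyz using hball
    have hle : P.card ≤ t.card := by
      refine Finset.card_le_card_of_injOn z (fun y hy => hzt y hy) fun y hy y' hy' e => ?_
      by_contra hne
      have h1 := (hP y hy y' hy').2 hne
      have h2 := hyz y hy
      have h3 := hyz y' hy'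
      rw [← e] at h3
      rw [Metric.mem_ball] at h2 h3
      rw [← Real.dist_eq] at h1
      have := dist_triangle_right y y' (z y)
      linarith
    have h4 : (n + 1) * (d / m) / (d / 8) = ((n + 1 : ℕ) : ℝ) * (8 / m) := by
      push_cast
      field_simp
    rw [h4, Real.mul_rpow (by positivity) (by positivity)] at htc
    have h5 : ((n + 1 : ℕ) : ℝ) ≤ t.card := by
      rw [hcard] at hle
      exact_mod_cast hle
    have h6 : (0 : ℝ) < ((n + 1 : ℕ) : ℝ) := by positivity
    rw [Real.rpow_sub h6, Real.rpow_one, div_le_iff₀ (Real.rpow_pos_of_pos h6 _)]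
    linarith
  have htend : Tendsto (fun n : ℕ => ((n + 1 : ℕ) : ℝ) ^ (1 - s)) atTop atTop :=
    (tendsto_rpow_atTop (by linarith : 0 < 1 - s)).comp
      (tendsto_natCast_atTop_atTop.comp (tendsto_add_atTop_nat 1))
  obtain ⟨n, hn⟩ := (htend.eventually_gt_atTop (K * (8 / m) ^ s)).exists
  exact absurd (hbound n) (not_le.2 hn)

end NotWSP

/-- **Dichotomy for self-similar subsets of the line.**  If `F` is a non-trivial
self-similar set in `ℝ`, attractor of an IFS of contracting similarities, then:
if the IFS satisfies the weak separation property the Assouad dimension of `F` equals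
its Hausdorff dimension, and otherwise the Assouad dimension equals `1`. -/
theorem assouad_dichotomy_line {ι : Type} [Fintype ι] [Nonempty ι]
    (S : ι → ℝ → ℝ) (c : ι → ℝ)
    (hc : ∀ i, c i ∈ Set.Ioo (0 : ℝ) 1)
    (hsim : ∀ i x y, dist (S i x) (S i y) = c i * dist x y)
    (F : Set ℝ) (hFcomp : IsCompact F) (hFne : F.Nonempty)
    (hFattr : F = ⋃ i, S i '' F)
    (hFnt : F.Nontrivial) :
    (SatisfiesWSP S → assouadDim F = (dimH F).toReal) ∧
    (¬ SatisfiesWSP S → assouadDim F = 1) := by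
  have hS : ∀ i, ∃ a b : ℝ, |a| = c i ∧ ∀ x, S i x = a * x + b :=
    fun i => similarity_eq_affine (hc i).1 (hsim i)
  have hS' : ∀ i, ∃ a b : ℝ, 0 < |a| ∧ |a| < 1 ∧ ∀ x, S i x = a * x + b := by
    intro i
    obtain ⟨a, b, ha, hab⟩ := hS i
    exact ⟨a, b, ha ▸ (hc i).1, ha ▸ (hc i).2, hab⟩
  obtain ⟨m, hm, hm1, hword⟩ := exists_word_of_size hc hS hFattr
  obtain ⟨R, hR⟩ := hFcomp.isBounded.exists_norm_le
  have hbdd : BddBelow {s : ℝ | 0 ≤ s ∧ AssouadBound F s} := ⟨0, fun s hs => hs.1⟩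
  have hone : (1 : ℝ) ∈ {s : ℝ | 0 ≤ s ∧ AssouadBound F s} := ⟨zero_le_one, assouadBound_one F⟩
  have hdef : assouadDim F = sInf {s : ℝ | 0 ≤ s ∧ AssouadBound F s} := rfl
  rw [hdef]
  refine ⟨fun hW => le_antisymm ?_ ?_, fun hW => le_antisymm (csInf_le hbdd hone) ?_⟩
  · obtain ⟨M, hM⟩ := hW.exists_cover hm hR hword
    refine le_of_forall_gt_imp_ge_of_dense fun s hs => csInf_le hbdd ?_
    have hs0 : 0 < s := ENNReal.toReal_nonneg.trans_lt hs
    exact ⟨hs0.le, assouadBound_of_exists_cover hFcomp hM hs0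
      ((ENNReal.lt_ofReal_iff_toReal_lt (Real.dimH_ne_top F)).2 hs)⟩
  · refine le_csInf ⟨1, hone⟩ fun s hs => ?_
    exact ENNReal.toReal_le_of_le_ofReal hs.1 (hs.2.dimH_le hFcomp hs.1)
  · refine le_csInf ⟨1, hone⟩ fun s hs => ?_
    refine hs.2.one_le_of_approximate_progression hm hm1 fun n ε hε =>
      exists_approximate_progression hFne hm (fun d hd => ?_) n hε
    obtain ⟨w₁, w₂, g, hg, hdisp⟩ :=
      exists_displacement_of_not_satisfiesWSP hW hS' hFnt hm hm1 hR hword hd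
    obtain ⟨a, b, ha0, ha1, hab⟩ := wordMap_affine hS' w₁
    refine ⟨wordMap S w₁, g, a, b, ha0, ha1, hab, fun x hx => wordMap_mem hFattr w₁ hx,
      fun x hx => ?_, hdisp⟩
    rw [← hg]
    exact wordMap_mem hFattr w₂ hx
end

section
/- Let F be a self-similar set in ℝ^d not contained in any (d−1)-dimensional hyperplane. If the defining IFS satisfies the weak separation property, then F is Ahlfors regular; in particular the Hausdorff dimension of F equals the Assouad dimension of F. -/
open Set Metric Filter Function MeasureTheory

open scoped ENNReal NNReal Topology

/-- `F` is the attractor of the finite family `S` of surjective contracting similarities with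
ratios `c`. -/
structure IsSelfSimilar {ι X : Type*} [MetricSpace X] (S : ι → X → X) (c : ι → ℝ)
    (F : Set X) : Prop where
  ratio_mem : ∀ i, c i ∈ Ioo (0 : ℝ) 1
  dist_map : ∀ i x y, dist (S i x) (S i y) = c i * dist x y
  surjective : ∀ i, Surjective (S i)
  isCompact : IsCompact F
  nonempty : F.Nonempty
  eq_iUnion : F = ⋃ i, S i '' F

/-- The contraction ratio of `wordMap S w`. -/
def wordRatio {ι : Type*} (c : ι → ℝ) (w : List ι) : ℝ := (w.map c).prod

@[simp] lemma wordRatio_nil {ι : Type*} (c : ι → ℝ) : wordRatio c [] = 1 := rfl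

@[simp] lemma wordRatio_cons {ι : Type*} (c : ι → ℝ) (i : ι) (w : List ι) :
    wordRatio c (i :: w) = c i * wordRatio c w := by
  simp [wordRatio]

namespace IsSelfSimilar

variable {ι X : Type*} [MetricSpace X] {S : ι → X → X} {c : ι → ℝ} {F : Set X}

lemma wordRatio_pos (h : IsSelfSimilar S c F) (w : List ι) : 0 < wordRatio c w := by
  induction w with
  | nil => simp
  | cons i w ih => rw [wordRatio_cons]; exact mul_pos (h.ratio_mem i).1 ih

lemma dist_wordMap (h : IsSelfSimilar S c F) (w : List ι) (x y : X) :
    dist (wordMap S w x) (wordMap S w y) = wordRatio c w * dist x y := by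
  induction w with
  | nil => simp [wordMap]
  | cons i w ih => simp only [wordMap, comp_apply, h.dist_map, ih, wordRatio_cons, mul_assoc]

lemma wordMap_surjective (h : IsSelfSimilar S c F) (w : List ι) : Surjective (wordMap S w) := by
  induction w with
  | nil => exact surjective_id
  | cons i w ih => exact (h.surjective i).comp ih

lemma wordMap_injective (h : IsSelfSimilar S c F) (w : List ι) : Injective (wordMap S w) := by
  intro x y hxy
  have h1 := h.dist_wordMap w x y
  rw [hxy, dist_self, eq_comm, mul_eq_zero] at h1
  exact dist_eq_zero.1 (h1.resolve_left (h.wordRatio_pos w).ne')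

lemma image_wordMap_subset (h : IsSelfSimilar S c F) (w : List ι) : wordMap S w '' F ⊆ F := by
  induction w with
  | nil => simp [wordMap]
  | cons i w ih =>
    rw [wordMap, image_comp]
    refine (image_mono ih).trans ?_
    conv_rhs => rw [h.eq_iUnion]
    exact subset_iUnion (fun i => S i '' F) i

lemma lipschitzWith_wordMap (h : IsSelfSimilar S c F) (w : List ι) :
    LipschitzWith (wordRatio c w).toNNReal (wordMap S w) :=
  LipschitzWith.of_dist_le_mul fun x y => by
    rw [h.dist_wordMap, Real.coe_toNNReal _ (h.wordRatio_pos w).le]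

lemma antilipschitzWith_wordMap (h : IsSelfSimilar S c F) (w : List ι) :
    AntilipschitzWith (wordRatio c w).toNNReal⁻¹ (wordMap S w) :=
  AntilipschitzWith.of_le_mul_dist fun x y => by
    rw [h.dist_wordMap, NNReal.coe_inv, Real.coe_toNNReal _ (h.wordRatio_pos w).le,
      inv_mul_cancel_left₀ (h.wordRatio_pos w).ne']

/-- Every point of the attractor lies in cylinders of every prescribed size. -/
lemma exists_word_of_mem [Finite ι] (h : IsSelfSimilar S c F) :
    ∃ m : ℝ, 0 < m ∧ m ≤ 1 ∧ ∀ x ∈ F, ∀ r : ℝ, 0 < r → r ≤ 1 →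
      ∃ w : List ι, x ∈ wordMap S w '' F ∧ m * r ≤ wordRatio c w ∧ wordRatio c w ≤ r := by
  have hne : Nonempty ι := by
    obtain ⟨x, hx⟩ := h.nonempty
    rw [h.eq_iUnion, mem_iUnion] at hx
    exact ⟨hx.choose⟩
  obtain ⟨i₀, hi₀⟩ := Finite.exists_min c
  obtain ⟨i₁, hi₁⟩ := Finite.exists_max c
  have hm := h.ratio_mem i₀
  have hq := h.ratio_mem i₁
  refine ⟨c i₀, hm.1, hm.2.le, ?_⟩
  have key : ∀ n : ℕ, ∀ x ∈ F, ∀ r : ℝ, 0 < r → r ≤ 1 → c i₁ ^ n ≤ r →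
      ∃ w : List ι, x ∈ wordMap S w '' F ∧ c i₀ * r ≤ wordRatio c w ∧ wordRatio c w ≤ r := by
    intro n
    induction n with
    | zero =>
      intro x hx r hr0 hr1 hr
      rw [pow_zero] at hr
      refine ⟨[], by simpa [wordMap] using hx, ?_, by simpa using hr⟩
      rw [wordRatio_nil]
      nlinarith [hm.1, hm.2]
    | succ n ih =>
      intro x hx r hr0 hr1 hr
      rw [h.eq_iUnion, mem_iUnion] at hx
      obtain ⟨i, y, hy, rfl⟩ := hx
      have hci := (h.ratio_mem i).1
      rcases le_or_gt (c i) r with hcr | hcr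
      · refine ⟨[i], ⟨y, hy, rfl⟩, ?_, by simpa using hcr⟩
        have := hi₀ i
        simp only [wordRatio_cons, wordRatio_nil, mul_one]
        nlinarith [hm.1]
      · obtain ⟨w, ⟨z, hz, rfl⟩, h1, h2⟩ := ih y hy (r / c i) (by positivity)
          ((div_le_one hci).2 hcr.le) (by
            rw [le_div_iff₀ hci]
            refine le_trans ?_ hr
            rw [pow_succ]
            exact mul_le_mul_of_nonneg_left (hi₁ i) (pow_nonneg hq.1.le n))
        refine ⟨i :: w, ⟨z, hz, rfl⟩, ?_, ?_⟩
        · rw [wordRatio_cons]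
          calc c i₀ * r = c i * (c i₀ * (r / c i)) := by field_simp
            _ ≤ _ := mul_le_mul_of_nonneg_left h1 hci.le
        · rw [wordRatio_cons, mul_comm]
          exact (le_div_iff₀ hci).1 h2
  intro x hx r hr0 hr1
  obtain ⟨n, hn⟩ := exists_pow_lt_of_lt_one hr0 hq.2
  exact key n x hx r hr0 hr1 hn.le

/-- Under weak separation, distinct cylinder maps are quantitatively apart on a fixed finite set. -/
lemma exists_le_dist_of_wsp [Nonempty ι] [Nonempty X] (h : IsSelfSimilar S c F)
    (hS : SatisfiesWSP S) :
    ∃ Z : Set X, Z.Finite ∧ ∃ ε : ℝ, 0 < ε ∧ ∀ w w' : List ι, wordMap S w ≠ wordMap S w' →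
      ∃ z ∈ Z, ε * wordRatio c w ≤ dist (wordMap S w z) (wordMap S w' z) := by
  have h1 : _ ∈ 𝓝 (id : X → X) := isClosed_closure.isOpen_compl.mem_nhds hS
  rw [nhds_pi, Filter.mem_pi] at h1
  obtain ⟨Z, hZ, t, ht, hsub⟩ := h1
  have h2 : ∀ᶠ ε : ℝ in 𝓝[>] 0, ∀ z ∈ Z, ball z ε ⊆ t z := by
    refine (eventually_all_finite hZ).2 fun z _ => ?_
    obtain ⟨δ, hδ, hδt⟩ := Metric.mem_nhds_iff.1 (ht z)
    filter_upwards [Ioc_mem_nhdsGT hδ] with ε hε using (ball_subset_ball hε.2).trans hδt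
  obtain ⟨ε, hε, hε0⟩ := (h2.and self_mem_nhdsWithin).exists
  refine ⟨Z, hZ, ε, hε0, fun w w' hww => ?_⟩
  by_contra! hcon
  obtain ⟨i⟩ := ‹Nonempty ι›
  set g := invFun (wordMap S (i :: w)) ∘ wordMap S (i :: w') with hg
  have hgw : ∀ z, wordMap S w (g z) = wordMap S w' z := fun z => by
    have h3 : wordMap S (i :: w) (g z) = wordMap S (i :: w') z :=
      rightInverse_invFun (h.wordMap_surjective (i :: w)) _
    have h4 := h.wordMap_injective [i]
    exact h4 h3
  refine hsub (a := g) (fun z hz => hε z hz ?_)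
    (subset_closure ⟨⟨i :: w, i :: w', by simp, by simp, ?_, hg⟩, ?_⟩)
  · have h3 := hcon z hz
    rw [← hgw, h.dist_wordMap, mul_comm, dist_comm] at h3
    exact lt_of_mul_lt_mul_right h3 (h.wordRatio_pos w).le
  · intro heq
    exact hww (by rw [(List.cons.inj heq).2])
  · intro hid
    refine hww (funext fun z => ?_)
    rw [← hgw z, hid, id]

/-- Under weak separation, a ball of radius `r` only meets a bounded number of distinct cylinders
of size comparable to `r`. -/
lemma exists_local_cover {E : Type*} [NormedAddCommGroup E] [NormedSpace ℝ E]
    [FiniteDimensional ℝ E] [Finite ι] [Nonempty ι] {S : ι → E → E} {F : Set E}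
    (h : IsSelfSimilar S c F) (hS : SatisfiesWSP S) :
    ∃ M : ℕ, ∀ (x : E) (r : ℝ), 0 < r → r ≤ 1 → ∃ T : Finset (List ι), T.card ≤ M ∧
      F ∩ ball x r ⊆ ⋃ w ∈ T, wordMap S w '' F ∧ ∀ w ∈ T, wordRatio c w ≤ r := by
  classical
  obtain ⟨Z, hZ, ε, hε, hsep⟩ := h.exists_le_dist_of_wsp hS
  obtain ⟨m, hm0, -, hm⟩ := h.exists_word_of_mem
  obtain ⟨D, hD⟩ := isBounded_iff.1 (hZ.isBounded.union h.isCompact.isBounded)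
  have := hZ.fintype
  have := FiniteDimensional.proper_real E
  obtain ⟨t, ht, hcov⟩ := Metric.totallyBounded_iff.1
    (isCompact_closedBall (0 : Z → E) (D + 1)).totallyBounded (ε * m / 2) (by positivity)
  have := ht.fintype
  refine ⟨t.toFinset.card, fun x r hr0 hr1 => ?_⟩
  set A : Set (List ι) := {w | m * r ≤ wordRatio c w ∧ wordRatio c w ≤ r ∧
    (wordMap S w '' F ∩ ball x r).Nonempty} with hA
  have hcode : ∀ w ∈ A, ∃ y ∈ t, dist (fun z : Z => r⁻¹ • (wordMap S w z - x)) y < ε * m / 2 := by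
    rintro w ⟨-, hw, _, ⟨y, hy, rfl⟩, hyx⟩
    have hmem : (fun z : Z => r⁻¹ • (wordMap S w z - x)) ∈ closedBall (0 : Z → E) (D + 1) := by
      have hD0 : 0 ≤ D := dist_nonneg.trans (hD (Or.inr hy) (Or.inr hy))
      rw [mem_closedBall, dist_zero_right, pi_norm_le_iff_of_nonneg (by positivity)]
      intro z
      rw [norm_smul, norm_inv, Real.norm_of_nonneg hr0.le, inv_mul_le_iff₀ hr0, ← dist_eq_norm]
      calc dist (wordMap S w z) x ≤ dist (wordMap S w z) (wordMap S w y) + dist (wordMap S w y) x :=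
            dist_triangle _ _ _
        _ ≤ r * D + r := by
            refine add_le_add ?_ (mem_ball.1 hyx).le
            rw [h.dist_wordMap]
            exact mul_le_mul hw (hD (Or.inl z.2) (Or.inr hy)) dist_nonneg hr0.le
        _ = r * (D + 1) := by ring
    simpa using hcov hmem
  choose! code hcode_mem hcode_dist using hcode
  have hinj : ∀ w ∈ A, ∀ w' ∈ A, code w = code w' → wordMap S w = wordMap S w' := by
    intro w hw w' hw' hww
    by_contra hne
    obtain ⟨z, hz, hd⟩ := hsep w w' hne
    have h1 : dist (fun z : Z => r⁻¹ • (wordMap S w z - x))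
        (fun z : Z => r⁻¹ • (wordMap S w' z - x)) < ε * m := by
      have h2 := hcode_dist w hw
      have h3 := hcode_dist w' hw'
      rw [← hww, dist_comm] at h3
      linarith [dist_triangle (fun z : Z => r⁻¹ • (wordMap S w z - x)) (code w)
        (fun z : Z => r⁻¹ • (wordMap S w' z - x))]
    have h2 := (dist_le_pi_dist (fun z : Z => r⁻¹ • (wordMap S w z - x))
      (fun z : Z => r⁻¹ • (wordMap S w' z - x)) ⟨z, hz⟩).trans_lt h1
    rw [dist_smul₀, dist_sub_right, norm_inv, Real.norm_of_nonneg hr0.le,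
      inv_mul_lt_iff₀ hr0] at h2
    have h3 := mul_le_mul_of_nonneg_left hw.1 hε.le
    linarith
  refine ⟨(t.toFinset.filter (· ∈ code '' A)).image (invFunOn code A),
    Finset.card_image_le.trans (Finset.card_filter_le _ _), ?_, ?_⟩
  · rintro y ⟨hyF, hyx⟩
    obtain ⟨w, hyw, hw1, hw2⟩ := hm y hyF r hr0 hr1
    have hw : w ∈ A := ⟨hw1, hw2, y, hyw, hyx⟩
    have hex : ∃ a ∈ A, code a = code w := ⟨w, hw, rfl⟩
    simp only [mem_iUnion]
    refine ⟨invFunOn code A (code w), ?_, ?_⟩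
    · refine Finset.mem_image_of_mem _ (Finset.mem_filter.2 ⟨?_, w, hw, rfl⟩)
      simpa using hcode_mem w hw
    · rwa [hinj _ (invFunOn_mem hex) w hw (invFunOn_eq hex)]
  · intro w hw
    obtain ⟨y, hy, rfl⟩ := Finset.mem_image.1 hw
    exact (invFunOn_mem (Finset.mem_filter.1 hy).2).2.1

end IsSelfSimilar

section BallCover

variable {X : Type*} [MetricSpace X]

/-- `A` has a finite cover by balls of radius at most `δ`, the `t`-th powers of the radii having
sum at most `v`. -/
def HasBallCover (A : Set X) (t δ v : ℝ) : Prop :=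
  ∃ (n : ℕ) (x : Fin n → X) (r : Fin n → ℝ), (∀ i, 0 < r i ∧ r i ≤ δ) ∧
    A ⊆ ⋃ i, ball (x i) (r i) ∧ ∑ i, r i ^ t ≤ v

lemma HasBallCover.mono {A : Set X} {t δ δ' v v' : ℝ}
    (h : HasBallCover A t δ v) (hδ : δ ≤ δ') (hv : v ≤ v') : HasBallCover A t δ' v' :=
  let ⟨n, x, r, hr, hA, hs⟩ := h
  ⟨n, x, r, fun i => ⟨(hr i).1, (hr i).2.trans hδ⟩, hA, hs.trans hv⟩

lemma HasBallCover.of_fintype {A : Set X} {t δ v : ℝ} {κ : Type*} [Fintype κ] (x : κ → X)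
    (r : κ → ℝ) (hr : ∀ i, 0 < r i ∧ r i ≤ δ) (hA : A ⊆ ⋃ i, ball (x i) (r i))
    (hv : ∑ i, r i ^ t ≤ v) : HasBallCover A t δ v := by
  let e := Fintype.equivFin κ
  refine ⟨Fintype.card κ, x ∘ e.symm, r ∘ e.symm, fun i => hr _, ?_, ?_⟩
  · exact hA.trans (e.symm.surjective.iUnion_comp fun i => ball (x i) (r i)).superset
  · exact (e.symm.sum_comp fun i => r i ^ t).trans_le hv

lemma HasBallCover.of_finset {A : Set X} {t ρ : ℝ} (P : Finset X) (hρ : 0 < ρ)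
    (hA : A ⊆ ⋃ y ∈ P, ball y ρ) : HasBallCover A t ρ (P.card * ρ ^ t) := by
  refine .of_fintype (fun y : P => (y : X)) (fun _ => ρ) (fun _ => ⟨hρ, le_rfl⟩) ?_ (by simp)
  rwa [iUnion_subtype]

variable [MeasurableSpace X] [BorelSpace X]

lemma hausdorffMeasure_le_of_hasBallCover {A : Set X} {t v : ℝ} (ht : 0 ≤ t)
    (h : ∀ δ : ℝ, 0 < δ → HasBallCover A t δ v) : μH[t] A ≤ ENNReal.ofReal (2 ^ t * v) := by
  have hpos : ∀ k : ℕ, (0 : ℝ) < 1 / (k + 1) := fun k => by positivity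
  choose n x r hr hA hv using fun k : ℕ => h _ (hpos k)
  have hdiam : ∀ k i, ediam (ball (x k i) (r k i)) ≤ ENNReal.ofReal (2 * r k i) := fun k i => by
    rw [← Metric.eball_ofReal, ENNReal.ofReal_mul zero_le_two, ENNReal.ofReal_ofNat]
    exact ediam_eball_le
  have hlim : Tendsto (fun k : ℕ => ENNReal.ofReal (2 * (1 / (k + 1)))) atTop (𝓝 0) := by
    have := (tendsto_one_div_add_atTop_nhds_zero_nat (𝕜 := ℝ)).const_mul 2
    simpa using ENNReal.tendsto_ofReal this
  refine (Measure.hausdorffMeasure_le_liminf_sum (l := atTop) t A _ hlim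
    (fun k i => ball (x k i) (r k i)) (.of_forall fun k i => (hdiam k i).trans
      (ENNReal.ofReal_le_ofReal (by linarith [(hr k i).2])))
    (.of_forall hA)).trans ?_
  refine liminf_le_of_le (by isBoundedDefault) fun b hb => ?_
  obtain ⟨k, hk⟩ := hb.exists
  refine hk.trans ?_
  calc ∑ i, ediam (ball (x k i) (r k i)) ^ t
      ≤ ∑ i, ENNReal.ofReal (2 ^ t * r k i ^ t) := by
        refine Finset.sum_le_sum fun i _ => ?_
        have h0 := (hr k i).1
        rw [← Real.mul_rpow zero_le_two h0.le, ← ENNReal.ofReal_rpow_of_nonneg (by positivity) ht]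
        exact ENNReal.rpow_le_rpow (hdiam k i) ht
    _ = ENNReal.ofReal (2 ^ t * ∑ i, r k i ^ t) := by
        rw [Finset.mul_sum, ENNReal.ofReal_sum_of_nonneg fun i _ => ?_]
        have h0 := (hr k i).1
        positivity
    _ ≤ _ := ENNReal.ofReal_le_ofReal (mul_le_mul_of_nonneg_left (hv k) (by positivity))

lemma hausdorffMeasure_eq_zero_of_hasBallCover {A : Set X} {t δ : ℝ} (ht : 0 < t)
    (h : ∀ ε : ℝ, 0 < ε → HasBallCover A t δ ε) : μH[t] A = 0 := by
  have key : ∀ ε : ℝ, 0 < ε → μH[t] A ≤ ENNReal.ofReal (2 ^ t * ε) := fun ε hε => by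
    refine hausdorffMeasure_le_of_hasBallCover ht.le fun η hη => ?_
    obtain ⟨n, x, r, hr, hA, hv⟩ := h (min ε (η ^ t)) (by positivity)
    refine ⟨n, x, r, fun i => ⟨(hr i).1, ?_⟩, hA, hv.trans (min_le_left _ _)⟩
    refine (Real.rpow_le_rpow_iff (hr i).1.le hη.le ht).1 ?_
    refine le_trans ?_ (hv.trans (min_le_right _ _))
    exact Finset.single_le_sum (f := fun i => r i ^ t)
      (fun j _ => Real.rpow_nonneg (hr j).1.le t) (Finset.mem_univ i)
  have hlim : Tendsto (fun ε : ℝ => ENNReal.ofReal (2 ^ t * ε)) (𝓝[>] 0) (𝓝 0) := by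
    have : Tendsto (fun ε : ℝ => 2 ^ t * ε) (𝓝 0) (𝓝 (2 ^ t * 0)) := tendsto_id.const_mul _
    have := (ENNReal.tendsto_ofReal this).mono_left (nhdsWithin_le_nhds (s := Ioi 0))
    simpa using this
  exact le_antisymm (ge_of_tendsto hlim (eventually_mem_nhdsWithin.mono key)) zero_le

lemma hasBallCover_of_hausdorffMeasure_eq_zero {A : Set X} {t ε : ℝ} (hA : IsCompact A)
    (ht : 0 < t) (h : μH[t] A = 0) (hε : 0 < ε) (hε1 : ε ≤ 1) : HasBallCover A t 1 ε := by
  rcases A.eq_empty_or_nonempty with rfl | ⟨x₀, hx₀⟩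
  · exact ⟨0, Fin.elim0, Fin.elim0, fun i => i.elim0, empty_subset _, by simpa using hε.le⟩
  rw [Measure.hausdorffMeasure_apply] at h
  have h1 := (iSup₂_eq_bot.1 h) 1 zero_lt_one
  have hε2 : ENNReal.ofReal (ε / 2) ≠ 0 := by simpa using hε
  have h2 := lt_of_eq_of_lt h1 (bot_lt_iff_ne_bot.2 hε2)
  simp only [iInf_lt_iff] at h2
  obtain ⟨U, hAU, hU1, hUs⟩ := h2
  obtain ⟨η, hη, hηs⟩ := ENNReal.exists_pos_sum_of_countable hε2 ℕ
  set v : ℕ → ℝ := fun n => (⨆ _ : (U n).Nonempty, ediam (U n) ^ t).toReal + η n with hv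
  have hvpos : ∀ n, 0 < v n := fun n => add_pos_of_nonneg_of_pos ENNReal.toReal_nonneg (hη n)
  have hfin : ∀ n, (⨆ _ : (U n).Nonempty, ediam (U n) ^ t) ≠ ∞ := fun n =>
    (ENNReal.le_tsum n |>.trans_lt hUs |>.trans ENNReal.ofReal_lt_top).ne
  have hball : ∀ n, ∃ x, U n ⊆ ball x (v n ^ t⁻¹) := fun n => by
    rcases (U n).eq_empty_or_nonempty with hn | ⟨x, hx⟩
    · exact ⟨x₀, by simp [hn]⟩
    · refine ⟨x, fun y hy => ?_⟩
      have hne : (U n).Nonempty := ⟨x, hx⟩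
      rw [mem_ball, ← Real.rpow_lt_rpow_iff dist_nonneg (by positivity [hvpos n]) ht,
        Real.rpow_inv_rpow (hvpos n).le ht.ne', hv]
      have h3 : edist y x ^ t ≤ ⨆ _ : (U n).Nonempty, ediam (U n) ^ t := by
        rw [iSup_pos hne]
        exact ENNReal.rpow_le_rpow (edist_le_ediam_of_mem hy hx) ht.le
      have h4 := ENNReal.toReal_mono (hfin n) h3
      rw [← ENNReal.toReal_rpow, edist_dist, ENNReal.toReal_ofReal dist_nonneg] at h4
      have : (0 : ℝ) < η n := hη n
      linarith
  choose x hx using hball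
  obtain ⟨T, hT⟩ := hA.elim_finite_subcover (fun n => ball (x n) (v n ^ t⁻¹))
    (fun n => isOpen_ball) (hAU.trans (iUnion_mono hx))
  have hsum : ∑ n ∈ T, v n ≤ ε := by
    rw [← ENNReal.ofReal_le_ofReal_iff hε.le, ENNReal.ofReal_sum_of_nonneg fun n _ => (hvpos n).le]
    calc ∑ n ∈ T, ENNReal.ofReal (v n)
        = ∑ n ∈ T, (⨆ _ : (U n).Nonempty, ediam (U n) ^ t) + ∑ n ∈ T, (η n : ℝ≥0∞) := by
          rw [← Finset.sum_add_distrib]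
          refine Finset.sum_congr rfl fun n _ => ?_
          simp only [hv]
          rw [ENNReal.ofReal_add ENNReal.toReal_nonneg (η n).coe_nonneg,
            ENNReal.ofReal_toReal (hfin n), ENNReal.ofReal_coe_nnreal]
      _ ≤ ENNReal.ofReal (ε / 2) + ENNReal.ofReal (ε / 2) :=
          add_le_add ((ENNReal.sum_le_tsum T).trans hUs.le) ((ENNReal.sum_le_tsum T).trans hηs.le)
      _ = ENNReal.ofReal ε := by
          rw [← ENNReal.ofReal_add (by positivity) (by positivity), add_halves]
  refine .of_fintype (fun n : T => x n) (fun n : T => v n ^ t⁻¹)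
    (fun n => ⟨Real.rpow_pos_of_pos (hvpos n) _, ?_⟩) (by rwa [iUnion_subtype]) ?_
  · refine Real.rpow_le_one (hvpos n).le ?_ (by positivity)
    exact (Finset.single_le_sum (f := v) (fun j _ => (hvpos j).le) n.2).trans (hsum.trans hε1)
  · simp_rw [Real.rpow_inv_rpow (hvpos _).le ht.ne']
    rwa [Finset.sum_coe_sort T v]

end BallCover

lemma hausdorffMeasure_of_toReal_dimH_lt {X : Type*} [MetricSpace X] [MeasurableSpace X]
    [BorelSpace X] {A : Set X} (hA : dimH A ≠ ∞) {t : ℝ} (ht : (dimH A).toReal < t) :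
    μH[t] A = 0 := by
  have ht0 : 0 < t := ENNReal.toReal_nonneg.trans_lt ht
  have h1 : dimH A < (t.toNNReal : ℝ≥0) := by
    rw [← ENNReal.ofReal_toReal hA]
    exact (ENNReal.ofReal_lt_ofReal_iff ht0).2 ht
  have h2 := hausdorffMeasure_of_dimH_lt h1
  rwa [Real.coe_toNNReal t ht0.le] at h2

namespace IsSelfSimilar

variable {ι X : Type*} [MetricSpace X] {S : ι → X → X} {c : ι → ℝ} {F : Set X}

/-- If some cylinders are mutually separated and the `t`-th powers of their ratios sum to at least
one, then the sum of the `t`-th powers of the radii of a finite ball cover is bounded below. -/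
lemma rpow_le_sum_of_separated (h : IsSelfSimilar S c F) {W : Finset (List ι)}
    (hW : W.Nontrivial) {δ t : ℝ} (hδ : 0 < δ) (ht : 0 ≤ t)
    (hsep : ∀ w ∈ W, ∀ w' ∈ W, w ≠ w' → ∀ x ∈ F, ∀ y ∈ F,
      2 * δ ≤ dist (wordMap S w x) (wordMap S w' y))
    (hsum : 1 ≤ ∑ w ∈ W, wordRatio c w ^ t) {κ : Type*} (T : Finset κ) (x : κ → X) (r : κ → ℝ)
    (hr : ∀ i ∈ T, 0 < r i) (hF : F ⊆ ⋃ i ∈ T, ball (x i) (r i)) :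
    δ ^ t ≤ ∑ i ∈ T, r i ^ t := by
  classical
  induction T using Finset.strongInduction generalizing x r with
  | H T ih =>
  have hr' : ∀ i ∈ T, 0 ≤ r i ^ t := fun i hi => Real.rpow_nonneg (hr i hi).le t
  by_cases hbig : ∃ i ∈ T, δ ≤ r i
  · obtain ⟨i, hi, hδi⟩ := hbig
    exact (Real.rpow_le_rpow hδ.le hδi ht).trans (Finset.single_le_sum hr' hi)
  push Not at hbig
  let G : List ι → Finset κ :=
    fun w => T.filter fun i => ∃ y ∈ F, wordMap S w y ∈ ball (x i) (r i)
  have hdisj : (W : Set (List ι)).PairwiseDisjoint G := by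
    intro w hw w' hw' hne
    refine Finset.disjoint_left.2 fun i hi hi' => ?_
    obtain ⟨hiT, y, hy, hyi⟩ := Finset.mem_filter.1 hi
    obtain ⟨-, y', hy', hyi'⟩ := Finset.mem_filter.1 hi'
    have h1 := hsep w hw w' hw' hne y hy y' hy'
    have h2 := dist_triangle_right (wordMap S w y) (wordMap S w' y') (x i)
    have h3 := hbig i hiT
    rw [mem_ball] at hyi hyi'
    linarith
  have hmem : ∀ w, ∀ y ∈ F, ∃ i ∈ G w, wordMap S w y ∈ ball (x i) (r i) := by
    intro w y hy
    have h1 := hF (h.image_wordMap_subset w ⟨y, hy, rfl⟩)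
    simp only [mem_iUnion] at h1
    obtain ⟨i, hi, hyi⟩ := h1
    exact ⟨i, Finset.mem_filter.2 ⟨hi, y, hy, hyi⟩, hyi⟩
  have hssub : ∀ w ∈ W, G w ⊂ T := by
    intro w hw
    refine (Finset.filter_subset _ _).ssubset_of_ne fun heq => ?_
    obtain ⟨w', hw', hne⟩ := hW.exists_ne w
    obtain ⟨y, hy⟩ := h.nonempty
    obtain ⟨i, hi, -⟩ := hmem w' y hy
    refine Finset.disjoint_left.1 (hdisj hw' hw hne) hi ?_
    rw [show G w = T from heq]
    exact (Finset.mem_filter.1 hi).1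
  have hcyl : ∀ w ∈ W, wordRatio c w ^ t * δ ^ t ≤ ∑ i ∈ G w, r i ^ t := by
    intro w hw
    have hc := h.wordRatio_pos w
    have h1 := ih (G w) (hssub w hw) (fun i => surjInv (h.wordMap_surjective w) (x i))
      (fun i => r i / wordRatio c w)
      (fun i hi => div_pos (hr i (Finset.mem_filter.1 hi).1) hc) (fun y hy => by
        obtain ⟨i, hi, hyi⟩ := hmem w y hy
        simp only [mem_iUnion]
        refine ⟨i, hi, ?_⟩
        rw [mem_ball, lt_div_iff₀ hc, mul_comm, ← h.dist_wordMap,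
          surjInv_eq (h.wordMap_surjective w)]
        exact hyi)
    calc wordRatio c w ^ t * δ ^ t
        ≤ wordRatio c w ^ t * ∑ i ∈ G w, (r i / wordRatio c w) ^ t :=
          mul_le_mul_of_nonneg_left h1 (by positivity)
      _ = ∑ i ∈ G w, r i ^ t := by
          rw [Finset.mul_sum]
          refine Finset.sum_congr rfl fun i hi => ?_
          have := hr i (Finset.mem_filter.1 hi).1
          rw [← Real.mul_rpow hc.le (by positivity), mul_div_cancel₀ _ hc.ne']
  calc δ ^ t ≤ (∑ w ∈ W, wordRatio c w ^ t) * δ ^ t :=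
        le_mul_of_one_le_left (by positivity) hsum
    _ ≤ ∑ w ∈ W, ∑ i ∈ G w, r i ^ t := by
        rw [Finset.sum_mul]
        exact Finset.sum_le_sum hcyl
    _ = ∑ i ∈ W.biUnion G, r i ^ t := (Finset.sum_biUnion hdisj).symm
    _ ≤ ∑ i ∈ T, r i ^ t := by
        refine Finset.sum_le_sum_of_subset_of_nonneg ?_ fun i hi _ => hr' i hi
        exact Finset.biUnion_subset.2 fun w _ => Finset.filter_subset _ _

variable [MeasurableSpace X] [BorelSpace X]

lemma hausdorffMeasure_ne_zero_of_separated (h : IsSelfSimilar S c F) {W : Finset (List ι)}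
    (hW : W.Nontrivial) {δ t : ℝ} (hδ : 0 < δ) (ht : 0 < t)
    (hsep : ∀ w ∈ W, ∀ w' ∈ W, w ≠ w' → ∀ x ∈ F, ∀ y ∈ F,
      2 * δ ≤ dist (wordMap S w x) (wordMap S w' y))
    (hsum : 1 ≤ ∑ w ∈ W, wordRatio c w ^ t) : μH[t] F ≠ 0 := by
  intro h0
  have hδt : 0 < δ ^ t := Real.rpow_pos_of_pos hδ t
  obtain ⟨n, x, r, hr, hF, hv⟩ := hasBallCover_of_hausdorffMeasure_eq_zero h.isCompact ht h0
    (ε := min 1 (δ ^ t / 2)) (by positivity) (min_le_left _ _)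
  have h1 := h.rpow_le_sum_of_separated hW hδ ht.le hsep hsum Finset.univ x r
    (fun i _ => (hr i).1) (by simpa using hF)
  linarith [min_le_right 1 (δ ^ t / 2)]

/-- The number of balls of radius `ρ` needed to cover a self-similar set is at most of order
`ρ ^ (-s)`, where `s` is the Hausdorff dimension. -/
lemma exists_finset_cover [Finite ι] (h : IsSelfSimilar S c F) (hdim : dimH F ≠ ∞) :
    ∃ C : ℝ, 0 < C ∧ ∀ ρ : ℝ, 0 < ρ → ρ ≤ 1 → ∃ P : Finset X, (F ⊆ ⋃ y ∈ P, ball y ρ) ∧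
      P.card * ρ ^ (dimH F).toReal ≤ C := by
  classical
  obtain ⟨m, hm0, hm1, hm⟩ := h.exists_word_of_mem
  obtain ⟨D, hD⟩ := isBounded_iff.1 h.isCompact.isBounded
  have hD0 : 0 ≤ D := by
    obtain ⟨x, hx⟩ := h.nonempty
    exact dist_nonneg.trans (hD hx hx)
  set s := (dimH F).toReal with hs
  have hs0 : 0 ≤ s := ENNReal.toReal_nonneg
  set κ : ℝ := 1 / (8 * (D + 1)) with hκ
  have hκ0 : 0 < κ := by positivity
  have hκ1 : κ ≤ 1 := by
    rw [hκ, div_le_one (by positivity)]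
    linarith
  have hκD : κ * D ≤ 1 / 8 := by
    rw [hκ, div_mul_eq_mul_div, div_le_div_iff₀ (by positivity) (by positivity)]
    linarith
  refine ⟨((m * κ) ^ s)⁻¹, by positivity, fun ρ hρ0 hρ1 => ?_⟩
  obtain ⟨N, hNF, hNfin, hN⟩ := Metric.exists_finite_isCover_of_isCompact
    (ε := (ρ / 4).toNNReal) (by simpa using hρ0) h.isCompact
  have hpack : packingNumber (2 * (ρ / 4).toNNReal) F ≠ ⊤ :=
    ((packingNumber_two_mul_le_externalCoveringNumber _ _).trans_lt
      ((hN.externalCoveringNumber_le_encard).trans_lt hNfin.encard_lt_top)).ne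
  have hε : 2 * (ρ / 4).toNNReal = (ρ / 2).toNNReal := by
    rw [← NNReal.coe_inj, NNReal.coe_mul, Real.coe_toNNReal _ (by positivity),
      Real.coe_toNNReal _ (by positivity), NNReal.coe_ofNat]
    ring
  rw [hε] at hpack
  have hPfin : (maximalSeparatedSet (ρ / 2).toNNReal F).Finite := by
    rw [← encard_lt_top_iff, encard_maximalSeparatedSet hpack]
    exact hpack.lt_top
  have hcov := isCover_iff_subset_iUnion_closedBall.1 (isCover_maximalSeparatedSet hpack)
  have hsepP := isSeparated_maximalSeparatedSet (ε := (ρ / 2).toNNReal) (A := F)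
  have hPF := maximalSeparatedSet_subset (ε := (ρ / 2).toNNReal) (A := F)
  obtain ⟨P, hP⟩ := hPfin.exists_finset_coe
  rw [← hP] at hcov hsepP hPF
  have hdist : ∀ x ∈ P, ∀ y ∈ P, x ≠ y → ρ / 2 < dist x y := fun x hx y hy hxy => by
    have h1 : ((ρ / 2).toNNReal : ℝ≥0∞) < edist x y := hsepP hx hy hxy
    rw [edist_dist, ENNReal.ofNNReal_toNNReal] at h1
    exact (ENNReal.ofReal_lt_ofReal_iff_of_nonneg (by positivity)).1 h1
  refine ⟨P, hcov.trans (iUnion₂_mono fun y _ => closedBall_subset_ball ?_), ?_⟩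
  · rw [Real.coe_toNNReal _ (by positivity)]
    linarith
  have hword : ∀ x ∈ P, ∃ w : List ι, x ∈ wordMap S w '' F ∧ m * (κ * ρ) ≤ wordRatio c w ∧
      wordRatio c w ≤ κ * ρ := fun x hx =>
    hm x (hPF hx) (κ * ρ) (by positivity) (mul_le_one₀ hκ1 hρ0.le hρ1)
  choose! ω hω hωl hωu using hword
  have hnear : ∀ x ∈ P, ∀ y ∈ F, dist x (wordMap S (ω x) y) ≤ ρ / 8 := fun x hx y hy => by
    obtain ⟨z, hz, hzx⟩ := hω x hx
    have heq : dist x (wordMap S (ω x) y) = wordRatio c (ω x) * dist z y := by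
      rw [← h.dist_wordMap, hzx]
    rw [heq]
    calc wordRatio c (ω x) * dist z y ≤ (κ * ρ) * D :=
          mul_le_mul (hωu x hx) (hD hz hy) dist_nonneg (by positivity)
      _ = (κ * D) * ρ := by ring
      _ ≤ 1 / 8 * ρ := mul_le_mul_of_nonneg_right hκD hρ0.le
      _ = ρ / 8 := by ring
  have hsepω : ∀ x ∈ P, ∀ y ∈ P, x ≠ y → ∀ a ∈ F, ∀ b ∈ F,
      2 * (ρ / 8) ≤ dist (wordMap S (ω x) a) (wordMap S (ω y) b) := by
    intro x hx y hy hxy a ha b hb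
    have h1 := hdist x hx y hy hxy
    have h2 := hnear x hx a ha
    have h3 := hnear y hy b hb
    have h4 := dist_triangle4 x (wordMap S (ω x) a) (wordMap S (ω y) b) y
    rw [dist_comm (wordMap S (ω y) b) y] at h4
    linarith
  have hinj : InjOn ω P := by
    intro x hx y hy hxy
    by_contra hne
    obtain ⟨a, ha⟩ := h.nonempty
    have h1 := hsepω x hx y hy hne a ha a ha
    rw [hxy, dist_self] at h1
    linarith
  have hbase : 0 < m * κ * ρ := by positivity
  have hbase1 : m * κ * ρ ≤ 1 := mul_le_one₀ (mul_le_one₀ hm1 hκ0.le hκ1) hρ0.le hρ1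
  have hle : (P.card : ℝ) * (m * κ * ρ) ^ s ≤ 1 := by
    rcases le_or_gt P.card 1 with hcard | hcard
    · have : (P.card : ℝ) ≤ 1 := by exact_mod_cast hcard
      exact mul_le_one₀ this (by positivity) (Real.rpow_le_one hbase.le hbase1 hs0)
    have hlim : Tendsto (fun t : ℝ => (P.card : ℝ) * (m * κ * ρ) ^ t) (𝓝[>] s)
        (𝓝 ((P.card : ℝ) * (m * κ * ρ) ^ s)) :=
      (((Real.continuous_const_rpow hbase.ne').tendsto s).const_mul _).mono_left
        nhdsWithin_le_nhds
    refine le_of_tendsto hlim (eventually_mem_nhdsWithin.mono fun t hst => ?_)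
    have ht0 : 0 < t := hs0.trans_lt hst
    by_contra! hcon
    have hnt : (P.image ω).Nontrivial := by
      rw [← Finset.one_lt_card_iff_nontrivial, Finset.card_image_of_injOn hinj]
      exact hcard
    refine h.hausdorffMeasure_ne_zero_of_separated (W := P.image ω) hnt
      (δ := ρ / 8) (t := t) (by positivity) ht0 ?_ ?_ ?_
    · intro w hw w' hw' hne
      obtain ⟨x, hx, rfl⟩ := Finset.mem_image.1 hw
      obtain ⟨y, hy, rfl⟩ := Finset.mem_image.1 hw'
      exact hsepω x hx y hy fun hxy => hne (by rw [hxy])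
    · rw [Finset.sum_image hinj]
      refine hcon.le.trans ?_
      rw [← nsmul_eq_mul]
      refine Finset.card_nsmul_le_sum _ _ _ fun x hx => ?_
      refine Real.rpow_le_rpow hbase.le ?_ ht0.le
      rw [mul_assoc]
      exact hωl x hx
    · exact hausdorffMeasure_of_toReal_dimH_lt hdim hst
  rw [Real.mul_rpow (by positivity) hρ0.le] at hle
  rw [← one_div, le_div_iff₀ (by positivity)]
  linarith

lemma hausdorffMeasure_dimH_ne_top [Finite ι] (h : IsSelfSimilar S c F) (hdim : dimH F ≠ ∞) :
    μH[(dimH F).toReal] F ≠ ∞ := by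
  obtain ⟨C, -, hC⟩ := h.exists_finset_cover hdim
  refine ne_top_of_le_ne_top ENNReal.ofReal_ne_top
    (hausdorffMeasure_le_of_hasBallCover (v := C) ENNReal.toReal_nonneg fun δ hδ => ?_)
  obtain ⟨P, hPF, hP⟩ := hC (min δ 1) (by positivity) (min_le_right _ _)
  exact (HasBallCover.of_finset P (by positivity) hPF).mono (min_le_left _ _) hP

lemma hausdorffMeasure_dimH_ne_zero (h : IsSelfSimilar S c F) (hdim : dimH F ≠ ∞) {M : ℕ}
    (hM : ∀ (x : X) (r : ℝ), 0 < r → r ≤ 1 → ∃ T : Finset (List ι), T.card ≤ M ∧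
      F ∩ ball x r ⊆ ⋃ w ∈ T, wordMap S w '' F ∧ ∀ w ∈ T, wordRatio c w ≤ r) :
    μH[(dimH F).toReal] F ≠ 0 := by
  set s := (dimH F).toReal with hs
  rcases (ENNReal.toReal_nonneg : 0 ≤ s).eq_or_lt with hs0 | hs0
  · have hs1 : s = 0 := hs0.symm
    rw [hs1]
    exact (zero_lt_one.trans_le
      (Measure.one_le_hausdorffMeasure_zero_of_nonempty h.nonempty)).ne'
  intro hzero
  obtain ⟨n, x, r, hr, hF, hv⟩ := hasBallCover_of_hausdorffMeasure_eq_zero h.isCompact hs0 hzero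
    (ε := 1 / (4 * (M + 1))) (by positivity) (by
      rw [div_le_one (by positivity)]
      have : (0 : ℝ) ≤ M := M.cast_nonneg
      linarith)
  have hMs : M * ∑ i, r i ^ s < 1 / 2 := by
    have h1 : (0 : ℝ) ≤ M := M.cast_nonneg
    refine (mul_le_mul_of_nonneg_left hv h1).trans_lt ?_
    rw [mul_one_div, div_lt_div_iff₀ (by positivity) (by positivity)]
    linarith
  have hcont : ContinuousAt (fun t : ℝ => M * ∑ i, r i ^ t) s := by
    refine continuousAt_const.mul (tendsto_finsetSum _ fun i _ => ?_)
    exact (Real.continuous_const_rpow (hr i).1.ne').tendsto s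
  obtain ⟨t, hMt, ht0, hts⟩ := ((hcont.eventually_lt continuousAt_const hMs).filter_mono
    (nhdsWithin_le_nhds (s := Iio s)) |>.and (Ioo_mem_nhdsLT hs0)).exists
  have hrt : ∀ i, 0 ≤ r i ^ t := fun i => Real.rpow_nonneg (hr i).1.le t
  have hstep : ∀ v, HasBallCover F t 1 v → HasBallCover F t 1 (v / 2) := by
    rintro v ⟨k, y, R, hR, hFR, hRv⟩
    choose T hTM hTF hTr using fun j => hM (y j) (R j) (hR j).1 (hR j).2
    refine .of_fintype (κ := Σ j : Fin k, T j × Fin n) (fun p => wordMap S p.2.1 (x p.2.2))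
      (fun p => wordRatio c p.2.1 * r p.2.2) ?_ ?_ ?_
    · rintro ⟨j, w, i⟩
      have hw := h.wordRatio_pos w
      exact ⟨mul_pos hw (hr i).1,
        mul_le_one₀ ((hTr j w w.2).trans (hR j).2) (hr i).1.le (hr i).2⟩
    · intro z hz
      obtain ⟨j, hj⟩ := mem_iUnion.1 (hFR hz)
      have h1 := hTF j ⟨hz, hj⟩
      simp only [mem_iUnion] at h1
      obtain ⟨w, hw, a, ha, rfl⟩ := h1
      obtain ⟨i, hi⟩ := mem_iUnion.1 (hF ha)
      refine mem_iUnion.2 ⟨⟨j, ⟨w, hw⟩, i⟩, ?_⟩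
      rw [mem_ball, h.dist_wordMap]
      exact mul_lt_mul_of_pos_left hi (h.wordRatio_pos w)
    · rw [Fintype.sum_sigma]
      have hj : ∀ j, ∑ p : T j × Fin n, (wordRatio c p.1 * r p.2) ^ t ≤ R j ^ t * (1 / 2) := by
        intro j
        calc ∑ p : T j × Fin n, (wordRatio c p.1 * r p.2) ^ t
            ≤ ∑ p : T j × Fin n, R j ^ t * r p.2 ^ t := by
              refine Finset.sum_le_sum fun p _ => ?_
              rw [Real.mul_rpow (h.wordRatio_pos _).le (hr _).1.le]
              exact mul_le_mul_of_nonneg_right (Real.rpow_le_rpow (h.wordRatio_pos _).le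
                (hTr j p.1 p.1.2) ht0.le) (hrt _)
          _ = R j ^ t * ((T j).card * ∑ i, r i ^ t) := by
              rw [Fintype.sum_prod_type]
              simp only [← Finset.mul_sum, Finset.sum_const, Finset.card_univ, Fintype.card_coe,
                nsmul_eq_mul]
          _ ≤ R j ^ t * (1 / 2) := by
              refine mul_le_mul_of_nonneg_left (le_trans ?_ hMt.le)
                (Real.rpow_nonneg (hR j).1.le t)
              exact mul_le_mul_of_nonneg_right (by exact_mod_cast hTM j)
                (Finset.sum_nonneg fun i _ => hrt i)
      refine (Finset.sum_le_sum fun j _ => hj j).trans ?_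
      rw [← Finset.sum_mul]
      linarith
  have hiter : ∀ k : ℕ, HasBallCover F t 1 ((∑ i, r i ^ t) * (1 / 2) ^ k) := by
    intro k
    induction k with
    | zero => exact ⟨n, x, r, hr, hF, by simp⟩
    | succ k ih => exact (hstep _ ih).mono le_rfl (by rw [pow_succ]; linarith)
  have hzero' : μH[t] F = 0 := by
    refine hausdorffMeasure_eq_zero_of_hasBallCover ht0 (δ := 1) fun ε hε => ?_
    have hlim : Tendsto (fun k : ℕ => (∑ i, r i ^ t) * (1 / 2 : ℝ) ^ k) atTop (𝓝 0) := by
      simpa using (tendsto_pow_atTop_nhds_zero_of_lt_one (r := (1 / 2 : ℝ)) (by norm_num)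
        (by norm_num)).const_mul (∑ i, r i ^ t)
    obtain ⟨k, hk⟩ := (hlim.eventually (Iio_mem_nhds hε)).exists
    exact (hiter k).mono le_rfl (le_of_lt hk)
  have h1 : ((t.toNNReal : ℝ≥0) : ℝ≥0∞) < dimH F := by
    rw [← ENNReal.ofReal_toReal hdim, ← hs]
    exact (ENNReal.ofReal_lt_ofReal_iff hs0).2 hts
  have h2 := hausdorffMeasure_of_lt_dimH h1
  rw [Real.coe_toNNReal t ht0.le, hzero'] at h2
  exact ENNReal.zero_ne_top h2

lemma hausdorffMeasure_image_wordMap (h : IsSelfSimilar S c F) (w : List ι) {t : ℝ} (ht : 0 ≤ t) :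
    μH[t] (wordMap S w '' F) = ENNReal.ofReal (wordRatio c w ^ t) * μH[t] F := by
  have hw := h.wordRatio_pos w
  have hpow : ((wordRatio c w).toNNReal : ℝ≥0∞) ^ t = ENNReal.ofReal (wordRatio c w ^ t) := by
    rw [ENNReal.ofNNReal_toNNReal, ENNReal.ofReal_rpow_of_pos hw]
  refine le_antisymm ?_ ?_
  · rw [← hpow]
    exact (h.lipschitzWith_wordMap w).hausdorffMeasure_image_le ht F
  · have h1 := (h.antilipschitzWith_wordMap w).le_hausdorffMeasure_image ht F
    have hne : (wordRatio c w).toNNReal ≠ 0 := by simpa using hw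
    rw [ENNReal.coe_inv hne, ENNReal.inv_rpow, hpow] at h1
    have hpos : 0 < wordRatio c w ^ t := Real.rpow_pos_of_pos hw t
    calc ENNReal.ofReal (wordRatio c w ^ t) * μH[t] F
        ≤ ENNReal.ofReal (wordRatio c w ^ t) *
          ((ENNReal.ofReal (wordRatio c w ^ t))⁻¹ * μH[t] (wordMap S w '' F)) :=
          mul_le_mul_right h1 _
      _ = μH[t] (wordMap S w '' F) := by
          rw [← mul_assoc, ENNReal.mul_inv_cancel (by simpa using hpos) ENNReal.ofReal_ne_top,
            one_mul]

/-- A self-similar set with uniformly bounded overlaps is Ahlfors regular. -/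
lemma exists_hausdorffMeasure_ball_bounds [Finite ι] (h : IsSelfSimilar S c F)
    (hdim : dimH F ≠ ∞) {M : ℕ}
    (hM : ∀ (x : X) (r : ℝ), 0 < r → r ≤ 1 → ∃ T : Finset (List ι), T.card ≤ M ∧
      F ∩ ball x r ⊆ ⋃ w ∈ T, wordMap S w '' F ∧ ∀ w ∈ T, wordRatio c w ≤ r) :
    ∃ a b : ℝ, 0 < a ∧ 0 < b ∧ ∀ x ∈ F, ∀ r : ℝ, 0 < r → r < 1 →
      ENNReal.ofReal (a * r ^ (dimH F).toReal) ≤ μH[(dimH F).toReal] (ball x r ∩ F) ∧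
      μH[(dimH F).toReal] (ball x r ∩ F) ≤ ENNReal.ofReal (b * r ^ (dimH F).toReal) := by
  obtain ⟨m, hm0, hm1, hm⟩ := h.exists_word_of_mem
  obtain ⟨D, hD⟩ := isBounded_iff.1 h.isCompact.isBounded
  have hD0 : 0 ≤ D := by
    obtain ⟨x, hx⟩ := h.nonempty
    exact dist_nonneg.trans (hD hx hx)
  have hne := h.hausdorffMeasure_dimH_ne_zero hdim hM
  have hfin := h.hausdorffMeasure_dimH_ne_top hdim
  set s := (dimH F).toReal with hs
  have hs0 : 0 ≤ s := ENNReal.toReal_nonneg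
  set H : ℝ := (μH[s] F).toReal with hH
  have hH0 : 0 < H := ENNReal.toReal_pos hne hfin
  have hHF : μH[s] F = ENNReal.ofReal H := (ENNReal.ofReal_toReal hfin).symm
  refine ⟨(m / (D + 1)) ^ s * H, (M + 1) * H, by positivity, by positivity,
    fun x hx r hr0 hr1 => ⟨?_, ?_⟩⟩
  · obtain ⟨w, ⟨y, hy, rfl⟩, hwl, hwu⟩ := hm x hx (r / (D + 1)) (by positivity)
      ((div_le_one (by positivity)).2 (by linarith))
    have hsub : wordMap S w '' F ⊆ ball (wordMap S w y) r ∩ F := by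
      refine subset_inter ?_ (h.image_wordMap_subset w)
      rintro _ ⟨z, hz, rfl⟩
      rw [mem_ball, h.dist_wordMap]
      calc wordRatio c w * dist z y ≤ r / (D + 1) * D :=
            mul_le_mul hwu (hD hz hy) dist_nonneg (by positivity)
        _ < r / (D + 1) * (D + 1) := mul_lt_mul_of_pos_left (by linarith) (by positivity)
        _ = r := by field_simp
    refine le_trans ?_ (measure_mono hsub)
    rw [h.hausdorffMeasure_image_wordMap w hs0, hHF,
      ← ENNReal.ofReal_mul (Real.rpow_nonneg (h.wordRatio_pos w).le s)]
    refine ENNReal.ofReal_le_ofReal ?_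
    calc (m / (D + 1)) ^ s * H * r ^ s = (m * (r / (D + 1))) ^ s * H := by
          rw [mul_right_comm, ← Real.mul_rpow (by positivity) hr0.le]
          ring_nf
      _ ≤ _ := mul_le_mul_of_nonneg_right
          (Real.rpow_le_rpow (by positivity) hwl hs0) hH0.le
  · obtain ⟨T, hTM, hTF, hTr⟩ := hM x r hr0 hr1.le
    rw [inter_comm]
    calc μH[s] (F ∩ ball x r) ≤ ∑ w ∈ T, μH[s] (wordMap S w '' F) :=
          (measure_mono hTF).trans (measure_biUnion_finset_le T _)
      _ ≤ ∑ w ∈ T, ENNReal.ofReal (r ^ s * H) := by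
          refine Finset.sum_le_sum fun w hw => ?_
          rw [h.hausdorffMeasure_image_wordMap w hs0, hHF,
            ← ENNReal.ofReal_mul (Real.rpow_nonneg (h.wordRatio_pos w).le s)]
          exact ENNReal.ofReal_le_ofReal (mul_le_mul_of_nonneg_right
            (Real.rpow_le_rpow (h.wordRatio_pos w).le (hTr w hw) hs0) hH0.le)
      _ = ENNReal.ofReal (T.card * (r ^ s * H)) := by
          rw [Finset.sum_const, nsmul_eq_mul, ENNReal.ofReal_mul T.card.cast_nonneg,
            ENNReal.ofReal_natCast]
      _ ≤ ENNReal.ofReal ((M + 1) * H * r ^ s) := by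
          refine ENNReal.ofReal_le_ofReal ?_
          have h1 : (T.card : ℝ) ≤ M + 1 := by exact_mod_cast hTM.trans M.le_succ
          calc (T.card : ℝ) * (r ^ s * H) ≤ (M + 1) * (r ^ s * H) :=
                mul_le_mul_of_nonneg_right h1 (by positivity)
            _ = _ := by ring

/-- For a self-similar set with uniformly bounded overlaps, the Hausdorff and Assouad dimensions
agree. -/
lemma toReal_dimH_eq_assouadDim [Finite ι] (h : IsSelfSimilar S c F)
    (hdim : dimH F ≠ ∞) {M : ℕ}
    (hM : ∀ (x : X) (r : ℝ), 0 < r → r ≤ 1 → ∃ T : Finset (List ι), T.card ≤ M ∧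
      F ∩ ball x r ⊆ ⋃ w ∈ T, wordMap S w '' F ∧ ∀ w ∈ T, wordRatio c w ≤ r) :
    (dimH F).toReal = assouadDim F := by
  classical
  symm
  unfold assouadDim
  apply IsLeast.csInf_eq
  refine ⟨⟨ENNReal.toReal_nonneg, ?_⟩, ?_⟩
  · obtain ⟨C, hC0, hC⟩ := h.exists_finset_cover hdim
    refine ⟨(M + 1) * C, by positivity, fun r ρ hρ0 hρr hr1 x hx => ?_⟩
    have hr0 := hρ0.trans hρr
    obtain ⟨T, hTM, hTF, hTr⟩ := hM x r hr0 hr1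
    obtain ⟨P, hPF, hP⟩ := hC (ρ / r) (by positivity) ((div_le_one hr0).2 hρr.le)
    refine ⟨T.biUnion fun w => P.image (wordMap S w), ?_, ?_⟩
    · intro y hy
      have h1 := hTF hy
      simp only [mem_iUnion] at h1
      obtain ⟨w, hw, a, ha, rfl⟩ := h1
      have h2 := hPF ha
      simp only [mem_iUnion] at h2
      obtain ⟨p, hp, hap⟩ := h2
      simp only [mem_iUnion]
      refine ⟨wordMap S w p,
        Finset.mem_biUnion.2 ⟨w, hw, Finset.mem_image_of_mem _ hp⟩, ?_⟩
      rw [mem_ball, h.dist_wordMap]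
      calc wordRatio c w * dist a p < wordRatio c w * (ρ / r) :=
            mul_lt_mul_of_pos_left hap (h.wordRatio_pos w)
        _ ≤ r * (ρ / r) := mul_le_mul_of_nonneg_right (hTr w hw) (by positivity)
        _ = ρ := by field_simp
    · have h1 : (T.biUnion fun w => P.image (wordMap S w)).card ≤ M * P.card :=
        (Finset.card_biUnion_le_card_mul T _ P.card fun w _ => Finset.card_image_le).trans
          (Nat.mul_le_mul_right _ hTM)
      have h2 : (P.card : ℝ) ≤ C * (r / ρ) ^ (dimH F).toReal := by
        rw [← inv_div ρ r, Real.inv_rpow (by positivity), ← div_eq_mul_inv,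
          le_div_iff₀ (by positivity)]
        exact hP
      calc ((T.biUnion fun w => P.image (wordMap S w)).card : ℝ) ≤ M * P.card := by
            exact_mod_cast h1
        _ ≤ (M + 1) * (C * (r / ρ) ^ (dimH F).toReal) :=
            mul_le_mul (by linarith) h2 (by positivity) (by positivity)
        _ = _ := by ring
  · rintro t ⟨ht0, K, hK0, hK⟩
    obtain ⟨N, hNF, hNfin, hN⟩ := finite_cover_balls_of_compact h.isCompact zero_lt_one
    lift N to Finset X using hNfin
    have hcov : ∀ δ : ℝ, 0 < δ → HasBallCover F t δ (N.card * K) := fun δ hδ => by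
      set ρ := min δ (1 / 2) with hρ
      have hρ0 : 0 < ρ := by positivity
      have hρ1 : ρ < 1 := (min_le_right _ _).trans_lt (by norm_num)
      choose! Q hQF hQ using fun x (hx : x ∈ F) => hK 1 ρ hρ0 hρ1 le_rfl x hx
      refine (HasBallCover.of_finset (ρ := ρ) (N.biUnion Q) hρ0 fun y hy => ?_).mono
        (min_le_left _ _) ?_
      · have h1 := hN hy
        simp only [mem_iUnion] at h1
        obtain ⟨x, hx, hyx⟩ := h1
        have h2 := hQF x (hNF hx) ⟨hy, hyx⟩
        simp only [mem_iUnion] at h2 ⊢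
        obtain ⟨q, hq, hyq⟩ := h2
        exact ⟨q, Finset.mem_biUnion.2 ⟨x, hx, hq⟩, hyq⟩
      · have hρt : 0 < ρ ^ t := Real.rpow_pos_of_pos hρ0 t
        calc ((N.biUnion Q).card : ℝ) * ρ ^ t ≤ (∑ x ∈ N, ((Q x).card : ℝ)) * ρ ^ t := by
              refine mul_le_mul_of_nonneg_right ?_ hρt.le
              exact_mod_cast Finset.card_biUnion_le
          _ ≤ (∑ x ∈ N, K * (1 / ρ) ^ t) * ρ ^ t :=
              mul_le_mul_of_nonneg_right
                (Finset.sum_le_sum fun x hx => hQ x (hNF hx)) hρt.le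
          _ = N.card * K := by
              rw [Finset.sum_const, nsmul_eq_mul, one_div, Real.inv_rpow hρ0.le]
              field_simp
    lift t to ℝ≥0 using ht0
    have h1 : dimH F ≤ (t : ℝ≥0) := by
      refine dimH_le_of_hausdorffMeasure_ne_top ?_
      exact ne_top_of_le_ne_top ENNReal.ofReal_ne_top
        (hausdorffMeasure_le_of_hasBallCover t.2 hcov)
    exact ENNReal.toReal_mono ENNReal.coe_ne_top h1

end IsSelfSimilar

/-- A map of a finite-dimensional Euclidean space scaling all distances by a positive factor is
surjective. -/
lemma surjective_of_dist_eq_mul {d : ℕ}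
    {f : EuclideanSpace ℝ (Fin d) → EuclideanSpace ℝ (Fin d)} {c : ℝ} (hc : 0 < c)
    (hf : ∀ x y, dist (f x) (f y) = c * dist x y) : Surjective f := by
  have hiso : Isometry fun x => c⁻¹ • f x := Isometry.of_dist_eq fun x y => by
    rw [dist_smul₀, hf, norm_inv, Real.norm_of_nonneg hc.le, inv_mul_cancel_left₀ hc.ne']
  intro y
  obtain ⟨x, hx⟩ := (hiso.affineIsometryOfStrictConvexSpace.toAffineIsometryEquiv rfl).surjective
    (c⁻¹ • y)
  have hx' : c⁻¹ • f x = c⁻¹ • y := hx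
  exact ⟨x, smul_right_injective _ (inv_ne_zero hc.ne') hx'⟩

/-- **WSP implies Ahlfors regularity.**  Let `F` be a self-similar set in `ℝ^d`,
attractor of an IFS of contracting similarities, not contained in any
`(d-1)`-dimensional hyperplane.  If the IFS satisfies the weak separation property,
then `F` is Ahlfors regular (with exponent `s = dim_H F`, for radii `0 < r < 1`),
and in particular the Hausdorff and Assouad dimensions of `F` coincide. -/
theorem wsp_implies_ahlfors_regular {d : ℕ} {ι : Type} [Fintype ι] [Nonempty ι]
    (S : ι → EuclideanSpace ℝ (Fin d) → EuclideanSpace ℝ (Fin d)) (c : ι → ℝ)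
    (hc : ∀ i, c i ∈ Set.Ioo (0 : ℝ) 1)
    (hsim : ∀ i x y, dist (S i x) (S i y) = c i * dist x y)
    (F : Set (EuclideanSpace ℝ (Fin d))) (hFcomp : IsCompact F) (hFne : F.Nonempty)
    (hFattr : F = ⋃ i, S i '' F)
    (hFspan : affineSpan ℝ F = ⊤)
    (hWSP : SatisfiesWSP S) :
    (∃ a b : ℝ, 0 < a ∧ 0 < b ∧ ∀ x ∈ F, ∀ r : ℝ, 0 < r → r < 1 →
        ENNReal.ofReal (a * r ^ (dimH F).toReal) ≤
            μH[(dimH F).toReal] (Metric.ball x r ∩ F) ∧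
        μH[(dimH F).toReal] (Metric.ball x r ∩ F) ≤
            ENNReal.ofReal (b * r ^ (dimH F).toReal)) ∧
    (dimH F).toReal = assouadDim F := by
  have h : IsSelfSimilar S c F :=
    ⟨hc, hsim, fun i => surjective_of_dist_eq_mul (hc i).1 (hsim i), hFcomp, hFne, hFattr⟩
  have hdim : dimH F ≠ ∞ := Real.dimH_ne_top F
  obtain ⟨M, hM⟩ := h.exists_local_cover hWSP
  exact ⟨h.exists_hausdorffMeasure_ball_bounds hdim hM, h.toReal_dimH_eq_assouadDim hdim hM⟩
end
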